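/- arXiv:1903.11855 — 8 statements merged into one kernel-verified Lean document; each statement's English description precedes it below -/
import Mathlib

section
/- Let R be a unital ring, let (P,Q,ψ) be an R-system and let (S,T,σ,B) be a graded covariant representation of (P,Q,ψ). Then B is semi-saturated, i.e. B_n = (B_1)^n and B_{-n} = (B_{-1})^n for every integer n > 0 (where (B_1)^n denotes the additive span of n-fold products of elements of B_1). -/
set_option maxHeartbeats 800000

/-- For additive subgroups `X Y` of a (possibly non-unital) ring `B`, `sMul X Y` is the
additive span of the set of products `x * y` with `x ∈ X`, `y ∈ Y`. -/
def sMul {B : Type*} [NonUnitalRing B] (X Y : AddSubgroup B) : AddSubgroup B :=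
  AddSubgroup.closure {z : B | ∃ x ∈ X, ∃ y ∈ Y, z = x * y}

/-- The `n`-fold product `X ⋯ X` of an additive subgroup of a ring, defined for `n ≥ 1`
(the value at `0` is junk). -/
def sPow {B : Type*} [NonUnitalRing B] (X : AddSubgroup B) : ℕ → AddSubgroup B
  | 0 => ⊥
  | 1 => X
  | n + 2 => sMul (sPow X (n + 1)) X

/-- A ℤ-grading of a (possibly non-unital) ring `B`: an internal direct sum decomposition
into additive subgroups with `B_i B_j ⊆ B_{i+j}`. -/
structure ZGrading (B : Type*) [NonUnitalRing B] where
  comp : ℤ → AddSubgroup B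
  isInternal : DirectSum.IsInternal comp
  mul_mem : ∀ {i j : ℤ} {x y : B}, x ∈ comp i → y ∈ comp j → x * y ∈ comp (i + j)

/-- A bimodule action of a (possibly non-unital) ring `R` on an abelian group `M`. -/
structure BimodAction (R M : Type*) [NonUnitalRing R] [AddCommGroup M] where
  lsmul : R → M → M
  rsmul : M → R → M
  lsmul_add : ∀ (r : R) (m m' : M), lsmul r (m + m') = lsmul r m + lsmul r m'
  add_lsmul : ∀ (r r' : R) (m : M), lsmul (r + r') m = lsmul r m + lsmul r' m
  rsmul_add : ∀ (m m' : M) (r : R), rsmul (m + m') r = rsmul m r + rsmul m' r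
  add_rsmul : ∀ (m : M) (r r' : R), rsmul m (r + r') = rsmul m r + rsmul m r'
  mul_lsmul : ∀ (r r' : R) (m : M), lsmul (r * r') m = lsmul r (lsmul r' m)
  rsmul_mul : ∀ (m : M) (r r' : R), rsmul m (r * r') = rsmul (rsmul m r) r'
  lsmul_rsmul : ∀ (r : R) (m : M) (r' : R), rsmul (lsmul r m) r' = lsmul r (rsmul m r')

/-- An `R`-system `(P, Q, ψ)`: `P` and `Q` are `R`-bimodules and
`ψ : P × Q → R` is biadditive and `R`-balanced/bilinear. -/
structure RSystem (R P Q : Type*) [NonUnitalRing R] [AddCommGroup P] [AddCommGroup Q] where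
  actP : BimodAction R P
  actQ : BimodAction R Q
  psi : P → Q → R
  psi_add_left : ∀ (p p' : P) (q : Q), psi (p + p') q = psi p q + psi p' q
  psi_add_right : ∀ (p : P) (q q' : Q), psi p (q + q') = psi p q + psi p q'
  psi_lsmul : ∀ (r : R) (p : P) (q : Q), psi (actP.lsmul r p) q = r * psi p q
  psi_rsmul : ∀ (p : P) (q : Q) (r : R), psi p (actQ.rsmul q r) = psi p q * r
  psi_mid : ∀ (p : P) (r : R) (q : Q), psi (actP.rsmul p r) q = psi p (actQ.lsmul r q)

/-- The `R`-system is unital: the bimodules `P` and `Q` are unital. -/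
def RSystem.IsUnital {R P Q : Type*} [Ring R] [AddCommGroup P] [AddCommGroup Q]
    (sys : RSystem R P Q) : Prop :=
  (∀ p, sys.actP.lsmul 1 p = p) ∧ (∀ p, sys.actP.rsmul p 1 = p) ∧
    (∀ q, sys.actQ.lsmul 1 q = q) ∧ (∀ q, sys.actQ.rsmul q 1 = q)

/-- An s-unital (possibly non-unital) ring. -/
def IsSUnitalRing (R : Type*) [NonUnitalRing R] : Prop :=
  ∀ r : R, (∃ u, u * r = r) ∧ (∃ v, r * v = r)

/-- The `R`-system is s-unital: `R` is s-unital and the bimodules `P`, `Q` are s-unital. -/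
def RSystem.IsSUnital {R P Q : Type*} [NonUnitalRing R] [AddCommGroup P] [AddCommGroup Q]
    (sys : RSystem R P Q) : Prop :=
  IsSUnitalRing R ∧
    (∀ p : P, (∃ r, sys.actP.lsmul r p = p) ∧ (∃ r, sys.actP.rsmul p r = p)) ∧
    (∀ q : Q, (∃ r, sys.actQ.lsmul r q = q) ∧ (∃ r, sys.actQ.rsmul q r = q))

/-- A covariant representation `(S, T, σ, B)` of an `R`-system `(P, Q, ψ)`. -/
structure CovRep {R P Q : Type*} [NonUnitalRing R] [AddCommGroup P] [AddCommGroup Q]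
    (sys : RSystem R P Q) (B : Type*) [NonUnitalRing B] where
  S : P → B
  T : Q → B
  σ : R → B
  S_add : ∀ p p', S (p + p') = S p + S p'
  T_add : ∀ q q', T (q + q') = T q + T q'
  σ_add : ∀ r r', σ (r + r') = σ r + σ r'
  σ_mul : ∀ r r', σ (r * r') = σ r * σ r'
  S_rsmul : ∀ p r, S (sys.actP.rsmul p r) = S p * σ r
  S_lsmul : ∀ r p, S (sys.actP.lsmul r p) = σ r * S p
  T_rsmul : ∀ q r, T (sys.actQ.rsmul q r) = T q * σ r
  T_lsmul : ∀ r q, T (sys.actQ.lsmul r q) = σ r * T q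
  σ_psi : ∀ p q, σ (sys.psi p q) = S p * T q

/-- A graded covariant representation: a surjective covariant representation together with a
ℤ-grading of `B` such that `σ(R) ⊆ B₀`, `T(Q) ⊆ B₁` and `S(P) ⊆ B₋₁`. -/
structure GradedCovRep {R P Q : Type*} [NonUnitalRing R] [AddCommGroup P] [AddCommGroup Q]
    (sys : RSystem R P Q) (B : Type*) [NonUnitalRing B] extends CovRep sys B where
  grading : ZGrading B
  surjective : NonUnitalSubring.closure (Set.range σ ∪ Set.range S ∪ Set.range T) = ⊤
  σ_mem : ∀ r, σ r ∈ grading.comp 0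
  T_mem : ∀ q, T q ∈ grading.comp 1
  S_mem : ∀ p, S p ∈ grading.comp (-1)

/-- The operator `θ_{q,p} : Q → Q`, `x ↦ q · ψ(p, x)`. -/
def theta {R P Q : Type*} [NonUnitalRing R] [AddCommGroup P] [AddCommGroup Q]
    (sys : RSystem R P Q) (q : Q) (p : P) : Q → Q :=
  fun x => sys.actQ.rsmul q (sys.psi p x)

/-- The operator `θ_{p,q} : P → P`, `y ↦ ψ(y, q) · p`. -/
def thetaOp {R P Q : Type*} [NonUnitalRing R] [AddCommGroup P] [AddCommGroup Q]
    (sys : RSystem R P Q) (p : P) (q : Q) : P → P :=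
  fun y => sys.actP.lsmul (sys.psi y q) p

/-- `F_P(Q)`: the additive span of the operators `θ_{q,p}`. -/
def FPQ {R P Q : Type*} [NonUnitalRing R] [AddCommGroup P] [AddCommGroup Q]
    (sys : RSystem R P Q) : AddSubgroup (Q → Q) :=
  AddSubgroup.closure {f | ∃ q p, f = theta sys q p}

/-- `F_Q(P)`: the additive span of the operators `θ_{p,q}`. -/
def FQP {R P Q : Type*} [NonUnitalRing R] [AddCommGroup P] [AddCommGroup Q]
    (sys : RSystem R P Q) : AddSubgroup (P → P) :=
  AddSubgroup.closure {f | ∃ p q, f = thetaOp sys p q}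

/-- Condition (FS). -/
def CondFS {R P Q : Type*} [NonUnitalRing R] [AddCommGroup P] [AddCommGroup Q]
    (sys : RSystem R P Q) : Prop :=
  ∀ (qs : List Q) (ps : List P), ∃ Θ ∈ FPQ sys, ∃ Φ ∈ FQP sys,
    (∀ q ∈ qs, Θ q = q) ∧ (∀ p ∈ ps, Φ p = p)

/-- Condition (FS'): `id_Q ∈ F_P(Q)` and `id_P ∈ F_Q(P)`. -/
def CondFS' {R P Q : Type*} [NonUnitalRing R] [AddCommGroup P] [AddCommGroup Q]
    (sys : RSystem R P Q) : Prop :=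
  (id : Q → Q) ∈ FPQ sys ∧ (id : P → P) ∈ FQP sys

theorem sMul_le {B : Type*} [NonUnitalRing B] {X Y Z : AddSubgroup B}
    (h : ∀ x ∈ X, ∀ y ∈ Y, x * y ∈ Z) : sMul X Y ≤ Z := by
  refine (AddSubgroup.closure_le _).2 ?_
  rintro _ ⟨x, hx, y, hy, rfl⟩
  exact h x hx y hy

theorem mul_mem_sMul {B : Type*} [NonUnitalRing B] {X Y : AddSubgroup B} {x y : B}
    (hx : x ∈ X) (hy : y ∈ Y) : x * y ∈ sMul X Y :=
  AddSubgroup.subset_closure ⟨x, hx, y, hy, rfl⟩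

theorem mul_mem_sPow_add {B : Type*} [NonUnitalRing B] {X : AddSubgroup B} {z : B} {k m : ℕ}
    (h : ∀ y ∈ sPow X (k + 1), z * y ∈ sPow X (m + 1)) (n : ℕ) :
    ∀ y ∈ sPow X (k + n + 1), z * y ∈ sPow X (m + n + 1) := by
  induction n with
  | zero => exact h
  | succ n ih =>
    refine sMul_le (Z := (sPow X (m + n + 2)).comap (AddMonoidHom.mulLeft z)) fun x hx y hy => ?_
    change z * (x * y) ∈ sMul (sPow X (m + n + 1)) X
    rw [← mul_assoc]
    exact mul_mem_sMul (ih x hx) hy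

namespace ZGrading

variable {B : Type*} [NonUnitalRing B] (G : ZGrading B)

theorem sPow_comp_le (a : ℤ) (n : ℕ) : sPow (G.comp a) (n + 1) ≤ G.comp ((n + 1 : ℕ) * a) := by
  induction n with
  | zero => simp [sPow]
  | succ n ih =>
    refine sMul_le fun x hx y hy => ?_
    have h := G.mul_mem (ih hx) hy
    convert h using 2
    push_cast
    ring

theorem zero_mul_sPow_mem {a : ℤ} {x : B} (hx : x ∈ G.comp 0) (n : ℕ) :
    ∀ y ∈ sPow (G.comp a) (n + 1), x * y ∈ sPow (G.comp a) (n + 1) := by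
  have h := mul_mem_sPow_add (X := G.comp a) (z := x) (k := 0) (m := 0)
    (fun y hy => by simpa [sPow] using G.mul_mem hx hy) n
  simpa only [Nat.zero_add] using h

theorem mul_sPow_mem {a : ℤ} {x : B} (hx : x ∈ G.comp a) (n : ℕ) :
    ∀ y ∈ sPow (G.comp a) (n + 1), x * y ∈ sPow (G.comp a) (n + 2) := by
  have h := mul_mem_sPow_add (X := G.comp a) (z := x) (k := 0) (m := 1)
    (fun y hy => mul_mem_sMul hx hy) n
  simpa only [Nat.zero_add, Nat.add_comm 1 n] using h

theorem neg_mul_sPow_mem {a b : ℤ} (hab : b + a = 0) {x : B} (hx : x ∈ G.comp b) (n : ℕ) :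
    ∀ y ∈ sPow (G.comp a) (n + 2), x * y ∈ sPow (G.comp a) (n + 1) := by
  have h := mul_mem_sPow_add (X := G.comp a) (z := x) (k := 1) (m := 0) (fun y hy => by
    refine sMul_le (Z := (G.comp a).comap (AddMonoidHom.mulLeft x)) (fun u hu v hv => ?_) hy
    change x * (u * v) ∈ G.comp a
    rw [← mul_assoc]
    simpa [hab] using G.mul_mem (G.mul_mem hx hu) hv) n
  simpa only [Nat.zero_add, Nat.add_comm 1 n] using h

/-- The part of each homogeneous component generated in degrees `-1`, `0` and `1`. -/
def saturatedComp : ℤ → AddSubgroup B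
  | Int.ofNat 0 => G.comp 0
  | Int.ofNat (n + 1) => sPow (G.comp 1) (n + 1)
  | Int.negSucc n => sPow (G.comp (-1)) (n + 1)

theorem saturatedComp_le (i : ℤ) : G.saturatedComp i ≤ G.comp i := by
  match i with
  | Int.ofNat 0 => exact le_rfl
  | Int.ofNat (n + 1) =>
    have h := G.sPow_comp_le 1 n
    rwa [mul_one] at h
  | Int.negSucc n =>
    have h := G.sPow_comp_le (-1) n
    rwa [mul_neg_one] at h

theorem zero_mul_saturatedComp_mem {x y : B} {i : ℤ} (hx : x ∈ G.comp 0)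
    (hy : y ∈ G.saturatedComp i) : x * y ∈ G.saturatedComp i := by
  match i with
  | Int.ofNat 0 =>
    have h := G.mul_mem hx hy
    rwa [zero_add] at h
  | Int.ofNat (n + 1) => exact G.zero_mul_sPow_mem hx n y hy
  | Int.negSucc n => exact G.zero_mul_sPow_mem hx n y hy

theorem one_mul_saturatedComp_mem {x y : B} {i : ℤ} (hx : x ∈ G.comp 1)
    (hy : y ∈ G.saturatedComp i) : x * y ∈ G.saturatedComp (1 + i) := by
  match i with
  | Int.ofNat 0 => exact G.mul_mem hx hy
  | Int.ofNat (n + 1) =>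
    rw [show 1 + Int.ofNat (n + 1) = Int.ofNat (n + 1 + 1) by simp; ring]
    exact G.mul_sPow_mem hx n y hy
  | Int.negSucc 0 => exact G.mul_mem hx hy
  | Int.negSucc (n + 1) =>
    rw [show 1 + Int.negSucc (n + 1) = Int.negSucc n by omega]
    exact G.neg_mul_sPow_mem (by norm_num) hx n y hy

theorem neg_one_mul_saturatedComp_mem {x y : B} {i : ℤ} (hx : x ∈ G.comp (-1))
    (hy : y ∈ G.saturatedComp i) : x * y ∈ G.saturatedComp (-1 + i) := by
  match i with
  | Int.ofNat 0 => exact G.mul_mem hx hy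
  | Int.ofNat 1 => exact G.mul_mem hx hy
  | Int.ofNat (n + 2) =>
    rw [show -1 + Int.ofNat (n + 2) = Int.ofNat (n + 1) by simp; ring]
    exact G.neg_mul_sPow_mem (by norm_num) hx n y hy
  | Int.negSucc n =>
    rw [show -1 + Int.negSucc n = Int.negSucc (n + 1) by omega]
    exact G.mul_sPow_mem hx n y hy

theorem mul_iSup_saturatedComp_mem {x : B} {a : ℤ}
    (h : ∀ i, ∀ y ∈ G.saturatedComp i, x * y ∈ G.saturatedComp (a + i)) :
    ∀ y ∈ ⨆ i, G.saturatedComp i, x * y ∈ ⨆ i, G.saturatedComp i := by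
  have hle : ⨆ i, G.saturatedComp i ≤
      (⨆ i, G.saturatedComp i).comap (AddMonoidHom.mulLeft x) :=
    iSup_le fun i y hy => AddSubgroup.mem_iSup_of_mem (a + i) (h i y hy)
  exact fun y hy => hle hy

theorem iSup_saturatedComp_eq_top
    (hgen : NonUnitalSubring.closure (G.comp 0 ∪ G.comp (-1) ∪ G.comp 1 : Set B) = ⊤) :
    ⨆ i, G.saturatedComp i = ⊤ := by
  refine eq_top_iff.2 fun b _ => ?_
  have hb : b ∈ NonUnitalSubring.closure (G.comp 0 ∪ G.comp (-1) ∪ G.comp 1 : Set B) :=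
    hgen ▸ NonUnitalSubring.mem_top b
  suffices h : b ∈ ⨆ i, G.saturatedComp i ∧
      ∀ y ∈ ⨆ i, G.saturatedComp i, b * y ∈ ⨆ i, G.saturatedComp i from h.1
  induction hb using NonUnitalSubring.closure_induction with
  | mem x hx =>
    rcases hx with (hx | hx) | hx
    · exact ⟨(le_iSup G.saturatedComp 0 : G.comp 0 ≤ _) hx, G.mul_iSup_saturatedComp_mem (a := 0)
        fun i y hy => by simpa using G.zero_mul_saturatedComp_mem hx hy⟩
    · exact ⟨(le_iSup G.saturatedComp (-1) : G.comp (-1) ≤ _) hx, G.mul_iSup_saturatedComp_mem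
        fun i y hy => G.neg_one_mul_saturatedComp_mem hx hy⟩
    · exact ⟨(le_iSup G.saturatedComp 1 : G.comp 1 ≤ _) hx, G.mul_iSup_saturatedComp_mem
        fun i y hy => G.one_mul_saturatedComp_mem hx hy⟩
  | zero => exact ⟨zero_mem _, fun y _ => by simp⟩
  | add x y _ _ hx hy =>
    exact ⟨add_mem (hx trivial).1 (hy trivial).1, fun z hz => by
      rw [add_mul]; exact add_mem ((hx trivial).2 z hz) ((hy trivial).2 z hz)⟩
  | neg x _ hx =>
    exact ⟨neg_mem (hx trivial).1, fun z hz => by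
      rw [neg_mul]; exact neg_mem ((hx trivial).2 z hz)⟩
  | mul x y _ _ hx hy =>
    exact ⟨(hx trivial).2 y (hy trivial).1, fun z hz => by
      rw [mul_assoc]; exact (hx trivial).2 _ ((hy trivial).2 z hz)⟩

theorem comp_eq_saturatedComp
    (hgen : NonUnitalSubring.closure (G.comp 0 ∪ G.comp (-1) ∪ G.comp 1 : Set B) = ⊤) (i : ℤ) :
    G.comp i = G.saturatedComp i := by
  have hdisj : Disjoint (⨆ (j) (_ : j ≠ i), G.saturatedComp j) (G.comp i) :=
    ((G.isInternal.addSubgroup_iSupIndep i).mono_right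
      (iSup₂_mono fun j _ => G.saturatedComp_le j)).symm
  have htop : G.saturatedComp i ⊔ ⨆ (j) (_ : j ≠ i), G.saturatedComp j = ⊤ := by
    rw [← G.iSup_saturatedComp_eq_top hgen, iSup_split_single G.saturatedComp i]
  calc G.comp i = (G.saturatedComp i ⊔ ⨆ (j) (_ : j ≠ i), G.saturatedComp j) ⊓ G.comp i := by
        rw [htop, top_inf_eq]
    _ = G.saturatedComp i := by
        rw [sup_inf_assoc_of_le _ (G.saturatedComp_le i), hdisj.eq_bot, sup_bot_eq]

end ZGrading

/-- Any graded covariant representation ring `B` of an `R`-system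
(`R` a unital ring) is semi-saturated: `B_n = (B_1)^n` and `B_{-n} = (B_{-1})^n`
for every integer `n > 0`. -/
theorem gradedCovRep_semiSaturated
    {R P Q B : Type*} [Ring R] [AddCommGroup P] [AddCommGroup Q] [NonUnitalRing B]
    (sys : RSystem R P Q) (rep : GradedCovRep sys B) :
    ∀ n : ℕ, 0 < n →
      rep.grading.comp (n : ℤ) = sPow (rep.grading.comp 1) n ∧
        rep.grading.comp (-(n : ℤ)) = sPow (rep.grading.comp (-1)) n := by
  have hgen : NonUnitalSubring.closure
      (rep.grading.comp 0 ∪ rep.grading.comp (-1) ∪ rep.grading.comp 1 : Set B) = ⊤ := by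
    refine top_unique (rep.surjective.symm.le.trans (NonUnitalSubring.closure_mono ?_))
    refine Set.union_subset_union (Set.union_subset_union ?_ ?_) ?_
    · exact Set.range_subset_iff.2 rep.σ_mem
    · exact Set.range_subset_iff.2 rep.S_mem
    · exact Set.range_subset_iff.2 rep.T_mem
  intro n hn
  obtain ⟨n, rfl⟩ := Nat.exists_eq_add_one.2 hn
  exact ⟨rep.grading.comp_eq_saturatedComp hgen (Int.ofNat (n + 1)),
    rep.grading.comp_eq_saturatedComp hgen (Int.negSucc n)⟩
end

section
/- Let R be a unital ring and let (P,Q,ψ) be a unital R-system. Then (P,Q,ψ) satisfies Condition (FS') if and only if (P,Q,ψ) satisfies Condition (FS), Q is finitely generated as a right R-module, and P is finitely generated as a left R-module. -/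
set_option maxHeartbeats 800000

/-- `Q` is finitely generated as a right `R`-module: there is a finite list of generators whose
right-`R`-span (together with sums) is all of `Q`. -/
def QFGRight {R P Q : Type*} [NonUnitalRing R] [AddCommGroup P] [AddCommGroup Q]
    (sys : RSystem R P Q) : Prop :=
  ∃ gs : List Q, ∀ q : Q,
    q ∈ AddSubgroup.closure ({x : Q | ∃ g ∈ gs, ∃ r : R, x = sys.actQ.rsmul g r} ∪ {x | x ∈ gs})

/-- `P` is finitely generated as a left `R`-module. -/
def PFGLeft {R P Q : Type*} [NonUnitalRing R] [AddCommGroup P] [AddCommGroup Q]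
    (sys : RSystem R P Q) : Prop :=
  ∃ gs : List P, ∀ p : P,
    p ∈ AddSubgroup.closure ({x : P | ∃ g ∈ gs, ∃ r : R, x = sys.actP.lsmul r g} ∪ {x | x ∈ gs})

/-- An operator in the additive span of the maps `x ↦ m · φ i x` has range contained in the span of
finitely many elements. -/
theorem exists_list_apply_mem_closure {R M ι : Type*} [AddCommGroup M]
    (act : M → R → M) (φ : ι → M → R) {f : M → M}
    (hf : f ∈ AddSubgroup.closure {f : M → M | ∃ m i, f = fun x => act m (φ i x)}) :
    ∃ gs : List M, ∀ x, f x ∈ AddSubgroup.closure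
      ({x : M | ∃ g ∈ gs, ∃ r : R, x = act g r} ∪ {x | x ∈ gs}) := by
  induction hf using AddSubgroup.closure_induction with
  | mem f hf =>
    obtain ⟨m, i, rfl⟩ := hf
    exact ⟨[m], fun x => AddSubgroup.subset_closure (Or.inl ⟨m, by simp, φ i x, rfl⟩)⟩
  | zero => exact ⟨[], fun x => zero_mem _⟩
  | add f g _ _ hf hg =>
    obtain ⟨l, hl⟩ := hf
    obtain ⟨k, hk⟩ := hg
    refine ⟨l ++ k, fun x => add_mem (AddSubgroup.closure_mono ?_ (hl x))
      (AddSubgroup.closure_mono ?_ (hk x))⟩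
    · rintro y (⟨g, hg, r, rfl⟩ | hy)
      · exact Or.inl ⟨g, List.mem_append_left _ hg, r, rfl⟩
      · exact Or.inr (List.mem_append_left _ hy)
    · rintro y (⟨g, hg, r, rfl⟩ | hy)
      · exact Or.inl ⟨g, List.mem_append_right _ hg, r, rfl⟩
      · exact Or.inr (List.mem_append_right _ hy)
  | neg f _ hf =>
    obtain ⟨l, hl⟩ := hf
    exact ⟨l, fun x => neg_mem (hl x)⟩

/-- Operators in the additive span of additive, action-equivariant maps are additive and
action-equivariant. -/
theorem map_add_and_map_act_of_mem_closure {R M : Type*} [AddCommGroup M]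
    (act : M → R → M) (act_add : ∀ m m' r, act (m + m') r = act m r + act m' r)
    {S : Set (M → M)} (hS_add : ∀ f ∈ S, ∀ x y, f (x + y) = f x + f y)
    (hS_act : ∀ f ∈ S, ∀ x r, f (act x r) = act (f x) r) {f : M → M}
    (hf : f ∈ AddSubgroup.closure S) :
    (∀ x y, f (x + y) = f x + f y) ∧ ∀ x r, f (act x r) = act (f x) r := by
  induction hf using AddSubgroup.closure_induction with
  | mem f hf => exact ⟨hS_add f hf, hS_act f hf⟩
  | zero =>
    exact ⟨fun x y => by simp,
      fun x r => ((AddMonoidHom.mk' (act · r) fun m m' => act_add m m' r).map_zero).symm⟩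
  | add f g _ _ hf hg =>
    refine ⟨fun x y => ?_, fun x r => ?_⟩
    · simp only [Pi.add_apply, hf.1, hg.1]
      abel
    · simp only [Pi.add_apply, hf.2, hg.2, act_add]
  | neg f _ hf =>
    refine ⟨fun x y => ?_, fun x r => ?_⟩
    · simp only [Pi.neg_apply, hf.1]
      abel
    · rw [Pi.neg_apply, Pi.neg_apply, hf.2]
      exact ((AddMonoidHom.mk' (act · r) fun m m' => act_add m m' r).map_neg (f x)).symm

/-- An additive, action-equivariant map fixing a generating list is the identity. -/
theorem eq_id_of_fixes_generators {R M : Type*} [AddCommGroup M] (act : M → R → M)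
    {f : M → M} (f_add : ∀ x y, f (x + y) = f x + f y) (f_act : ∀ x r, f (act x r) = act (f x) r)
    {gs : List M} (hfix : ∀ g ∈ gs, f g = g)
    (hgs : ∀ x, x ∈ AddSubgroup.closure
      ({x : M | ∃ g ∈ gs, ∃ r : R, x = act g r} ∪ {x | x ∈ gs})) :
    f = id := by
  have h := AddMonoidHom.eqOn_closure (f := AddMonoidHom.mk' f f_add) (g := AddMonoidHom.id M)
    (s := {x : M | ∃ g ∈ gs, ∃ r : R, x = act g r} ∪ {x | x ∈ gs}) (by
      rintro y (⟨g, hg, r, rfl⟩ | hy)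
      · exact (f_act g r).trans (by rw [hfix g hg]; rfl)
      · exact hfix y hy)
  exact funext fun x => h (hgs x)

/-- For a unital `R`-system, Condition (FS') holds if and only if Condition (FS)
holds, `Q` is finitely generated as a right `R`-module, and `P` is finitely generated as a left
`R`-module. -/
theorem condFS'_iff_condFS_and_fg
    {R P Q : Type*} [Ring R] [AddCommGroup P] [AddCommGroup Q]
    (sys : RSystem R P Q) (hu : sys.IsUnital) :
    CondFS' sys ↔ (CondFS sys ∧ QFGRight sys ∧ PFGLeft sys) := by
  constructor
  · rintro ⟨hQ, hP⟩
    refine ⟨fun _ _ => ⟨id, hQ, id, hP, fun _ _ => rfl, fun _ _ => rfl⟩, ?_, ?_⟩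
    · exact exists_list_apply_mem_closure sys.actQ.rsmul sys.psi hQ
    · exact exists_list_apply_mem_closure (fun p r => sys.actP.lsmul r p)
        (fun q p => sys.psi p q) hP
  · rintro ⟨hFS, ⟨qs, hqs⟩, ⟨ps, hps⟩⟩
    obtain ⟨Θ, hΘ, Φ, hΦ, hΘfix, hΦfix⟩ := hFS qs ps
    have hΘlin := map_add_and_map_act_of_mem_closure sys.actQ.rsmul sys.actQ.rsmul_add
      (by
        rintro _ ⟨q, p, rfl⟩ x y
        simp only [theta, sys.psi_add_right, sys.actQ.add_rsmul])
      (by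
        rintro _ ⟨q, p, rfl⟩ x r
        simp only [theta, sys.psi_rsmul, sys.actQ.rsmul_mul]) hΘ
    have hΦlin := map_add_and_map_act_of_mem_closure (fun p r => sys.actP.lsmul r p)
      (fun p p' r => sys.actP.lsmul_add r p p')
      (by
        rintro _ ⟨p, q, rfl⟩ x y
        simp only [thetaOp, sys.psi_add_left, sys.actP.add_lsmul])
      (by
        rintro _ ⟨p, q, rfl⟩ x r
        simp only [thetaOp, sys.psi_lsmul, sys.actP.mul_lsmul]) hΦ
    have hΘid : Θ = id := eq_id_of_fixes_generators sys.actQ.rsmul hΘlin.1 hΘlin.2 hΘfix hqs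
    have hΦid : Φ = id := eq_id_of_fixes_generators (fun p r => sys.actP.lsmul r p)
      hΦlin.1 hΦlin.2 hΦfix hps
    exact ⟨hΘid ▸ hΘ, hΦid ▸ hΦ⟩
end

section
/- Let R be a unital ring and let (P,Q,ψ) be a unital R-system satisfying Condition (FS'). Then F_P(Q) = L_P(Q) and F_Q(P) = L_Q(P), and these are unital rings with multiplicative identity elements id_Q and id_P respectively. Here L_P(Q) is the set of adjointable operators on Q: right R-module endomorphisms T of Q for which there exists a left R-module endomorphism S of P with ψ(p, T(q)) = ψ(S(p), q) for all p ∈ P, q ∈ Q; L_Q(P) is defined symmetrically. -/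
set_option maxHeartbeats 800000

/-- `L_P(Q)`: adjointable operators on `Q`; right `R`-module endomorphisms `T` of `Q` admitting
an adjoint left `R`-module endomorphism `S` of `P` with `ψ(p, T q) = ψ(S p, q)`. -/
def LPQ {R P Q : Type*} [NonUnitalRing R] [AddCommGroup P] [AddCommGroup Q]
    (sys : RSystem R P Q) : Set (Q → Q) :=
  {T | (∀ x y : Q, T (x + y) = T x + T y) ∧
    (∀ (q : Q) (r : R), T (sys.actQ.rsmul q r) = sys.actQ.rsmul (T q) r) ∧
    ∃ S : P → P, (∀ x y : P, S (x + y) = S x + S y) ∧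
      (∀ (r : R) (p : P), S (sys.actP.lsmul r p) = sys.actP.lsmul r (S p)) ∧
      ∀ (p : P) (q : Q), sys.psi p (T q) = sys.psi (S p) q}

/-- `L_Q(P)`: adjointable operators on `P`, defined symmetrically. -/
def LQP {R P Q : Type*} [NonUnitalRing R] [AddCommGroup P] [AddCommGroup Q]
    (sys : RSystem R P Q) : Set (P → P) :=
  {S | (∀ x y : P, S (x + y) = S x + S y) ∧
    (∀ (r : R) (p : P), S (sys.actP.lsmul r p) = sys.actP.lsmul r (S p)) ∧
    ∃ T : Q → Q, (∀ x y : Q, T (x + y) = T x + T y) ∧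
      (∀ (q : Q) (r : R), T (sys.actQ.rsmul q r) = sys.actQ.rsmul (T q) r) ∧
      ∀ (p : P) (q : Q), sys.psi p (T q) = sys.psi (S p) q}

/-- The additive group of pairs `(T, S)` of mutually adjoint module endomorphisms of `Q`
and `P`. -/
def adjointPairs {R P Q : Type*} [NonUnitalRing R] [AddCommGroup P] [AddCommGroup Q]
    (sys : RSystem R P Q) : AddSubgroup ((Q → Q) × (P → P)) where
  carrier := {A | ((∀ x y, A.1 (x + y) = A.1 x + A.1 y) ∧
      ∀ q r, A.1 (sys.actQ.rsmul q r) = sys.actQ.rsmul (A.1 q) r) ∧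
    ((∀ x y, A.2 (x + y) = A.2 x + A.2 y) ∧
      ∀ r p, A.2 (sys.actP.lsmul r p) = sys.actP.lsmul r (A.2 p)) ∧
    ∀ p q, sys.psi p (A.1 q) = sys.psi (A.2 p) q}
  zero_mem' := by
    have h₁ (r : R) : sys.actQ.rsmul 0 r = 0 := by simpa using sys.actQ.rsmul_add 0 0 r
    have h₂ (r : R) : sys.actP.lsmul r 0 = 0 := by simpa using sys.actP.lsmul_add r 0 0
    have h₃ (p : P) : sys.psi p 0 = 0 := by simpa using sys.psi_add_right p 0 0
    have h₄ (q : Q) : sys.psi 0 q = 0 := by simpa using sys.psi_add_left 0 0 q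
    simp [h₁, h₂, h₃, h₄]
  add_mem' := by
    rintro ⟨T, S⟩ ⟨T', S'⟩ ⟨⟨a, b⟩, ⟨c, d⟩, e⟩ ⟨⟨a', b'⟩, ⟨c', d'⟩, e'⟩
    dsimp only at a b c d e a' b' c' d' e'
    refine ⟨⟨fun x y => ?_, fun q r => ?_⟩, ⟨fun x y => ?_, fun r p => ?_⟩, fun p q => ?_⟩
    · simp only [Prod.mk_add_mk, Pi.add_apply, a, a']
      abel
    · simp only [Prod.mk_add_mk, Pi.add_apply, b, b', sys.actQ.rsmul_add]
    · simp only [Prod.mk_add_mk, Pi.add_apply, c, c']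
      abel
    · simp only [Prod.mk_add_mk, Pi.add_apply, d, d', sys.actP.lsmul_add]
    · simp only [Prod.mk_add_mk, Pi.add_apply, e, e', sys.psi_add_left, sys.psi_add_right]
  neg_mem' := by
    rintro ⟨T, S⟩ ⟨⟨a, b⟩, ⟨c, d⟩, e⟩
    dsimp only at a b c d e
    have h₁ (q : Q) (r : R) : sys.actQ.rsmul (-q) r = -sys.actQ.rsmul q r :=
      (AddMonoidHom.mk' (sys.actQ.rsmul · r) fun x y => sys.actQ.rsmul_add x y r).map_neg q
    have h₂ (r : R) (p : P) : sys.actP.lsmul r (-p) = -sys.actP.lsmul r p :=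
      (AddMonoidHom.mk' (sys.actP.lsmul r) (sys.actP.lsmul_add r)).map_neg p
    have h₃ (p : P) (q : Q) : sys.psi p (-q) = -sys.psi p q :=
      (AddMonoidHom.mk' (sys.psi p) (sys.psi_add_right p)).map_neg q
    have h₄ (p : P) (q : Q) : sys.psi (-p) q = -sys.psi p q :=
      (AddMonoidHom.mk' (sys.psi · q) fun x y => sys.psi_add_left x y q).map_neg p
    refine ⟨⟨fun x y => ?_, fun q r => ?_⟩, ⟨fun x y => ?_, fun r p => ?_⟩, fun p q => ?_⟩
    · simp only [Prod.neg_mk, Pi.neg_apply, a, neg_add]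
    · simp only [Prod.neg_mk, Pi.neg_apply, b, h₁]
    · simp only [Prod.neg_mk, Pi.neg_apply, c, neg_add]
    · simp only [Prod.neg_mk, Pi.neg_apply, d, h₂]
    · simp only [Prod.neg_mk, Pi.neg_apply, e, h₃, h₄]

theorem theta_thetaOp_mem_adjointPairs {R P Q : Type*} [NonUnitalRing R] [AddCommGroup P]
    [AddCommGroup Q] (sys : RSystem R P Q) (q : Q) (p : P) :
    (theta sys q p, thetaOp sys p q) ∈ adjointPairs sys := by
  refine ⟨⟨fun x y => ?_, fun x r => ?_⟩, ⟨fun x y => ?_, fun r x => ?_⟩, fun x y => ?_⟩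
  · simp only [theta, sys.psi_add_right, sys.actQ.add_rsmul]
  · simp only [theta, sys.psi_rsmul, sys.actQ.rsmul_mul]
  · simp only [thetaOp, sys.psi_add_left, sys.actP.add_lsmul]
  · simp only [thetaOp, sys.psi_lsmul, sys.actP.mul_lsmul]
  · simp only [theta, thetaOp, sys.psi_rsmul, sys.psi_lsmul]

theorem FPQ_subset_LPQ {R P Q : Type*} [NonUnitalRing R] [AddCommGroup P] [AddCommGroup Q]
    (sys : RSystem R P Q) : (FPQ sys : Set (Q → Q)) ⊆ LPQ sys := by
  intro f hf
  have h : FPQ sys ≤ (adjointPairs sys).map (AddMonoidHom.fst _ _) := by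
    refine (AddSubgroup.closure_le _).2 ?_
    rintro _ ⟨q, p, rfl⟩
    exact ⟨_, theta_thetaOp_mem_adjointPairs sys q p, rfl⟩
  obtain ⟨⟨T, S⟩, ⟨⟨a, b⟩, ⟨c, d⟩, e⟩, rfl⟩ := h hf
  exact ⟨a, b, S, c, d, e⟩

theorem FQP_subset_LQP {R P Q : Type*} [NonUnitalRing R] [AddCommGroup P] [AddCommGroup Q]
    (sys : RSystem R P Q) : (FQP sys : Set (P → P)) ⊆ LQP sys := by
  intro f hf
  have h : FQP sys ≤ (adjointPairs sys).map (AddMonoidHom.snd _ _) := by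
    refine (AddSubgroup.closure_le _).2 ?_
    rintro _ ⟨p, q, rfl⟩
    exact ⟨_, theta_thetaOp_mem_adjointPairs sys q p, rfl⟩
  obtain ⟨⟨T, S⟩, ⟨⟨a, b⟩, ⟨c, d⟩, e⟩, rfl⟩ := h hf
  exact ⟨c, d, T, a, b, e⟩

theorem comp_mem_FPQ {R P Q : Type*} [NonUnitalRing R] [AddCommGroup P] [AddCommGroup Q]
    (sys : RSystem R P Q) {T g : Q → Q} (hT : T ∈ LPQ sys) (hg : g ∈ FPQ sys) :
    T ∘ g ∈ FPQ sys := by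
  let φ : (Q → Q) →+ (Q → Q) :=
    AddMonoidHom.mk' (T ∘ ·) fun f g => funext fun x => hT.1 (f x) (g x)
  suffices h : FPQ sys ≤ (FPQ sys).comap φ from h hg
  refine (AddSubgroup.closure_le _).2 ?_
  rintro _ ⟨q, p, rfl⟩
  exact AddSubgroup.subset_closure ⟨T q, p, funext fun x => hT.2.1 q _⟩

theorem comp_mem_FQP {R P Q : Type*} [NonUnitalRing R] [AddCommGroup P] [AddCommGroup Q]
    (sys : RSystem R P Q) {S g : P → P} (hS : S ∈ LQP sys) (hg : g ∈ FQP sys) :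
    S ∘ g ∈ FQP sys := by
  let φ : (P → P) →+ (P → P) :=
    AddMonoidHom.mk' (S ∘ ·) fun f g => funext fun x => hS.1 (f x) (g x)
  suffices h : FQP sys ≤ (FQP sys).comap φ from h hg
  refine (AddSubgroup.closure_le _).2 ?_
  rintro _ ⟨p, q, rfl⟩
  exact AddSubgroup.subset_closure ⟨S p, q, funext fun x => hS.2.1 _ p⟩

/-- For a unital `R`-system satisfying Condition (FS'), `F_P(Q) = L_P(Q)` and
`F_Q(P) = L_Q(P)`, and these are unital rings (closed under composition) with multiplicative
identity elements `id_Q` and `id_P` respectively. -/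
theorem FPQ_eq_LPQ_of_condFS'
    {R P Q : Type*} [Ring R] [AddCommGroup P] [AddCommGroup Q]
    (sys : RSystem R P Q) (hu : sys.IsUnital) (hfs : CondFS' sys) :
    ((FPQ sys : Set (Q → Q)) = LPQ sys) ∧ ((FQP sys : Set (P → P)) = LQP sys) ∧
    (∀ f ∈ FPQ sys, ∀ g ∈ FPQ sys, f ∘ g ∈ FPQ sys) ∧
    (∀ f ∈ FQP sys, ∀ g ∈ FQP sys, f ∘ g ∈ FQP sys) ∧
    ((id : Q → Q) ∈ FPQ sys ∧ ∀ f ∈ FPQ sys, id ∘ f = f ∧ f ∘ id = f) ∧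
    ((id : P → P) ∈ FQP sys ∧ ∀ f ∈ FQP sys, id ∘ f = f ∧ f ∘ id = f) := by
  exact ⟨(FPQ_subset_LPQ sys).antisymm fun _ hT => comp_mem_FPQ sys hT hfs.1,
    (FQP_subset_LQP sys).antisymm fun _ hS => comp_mem_FQP sys hS hfs.2,
    fun _ hf _ hg => comp_mem_FPQ sys (FPQ_subset_LPQ sys hf) hg,
    fun _ hf _ hg => comp_mem_FQP sys (FQP_subset_LQP sys hf) hg,
    ⟨hfs.1, fun _ _ => ⟨rfl, rfl⟩⟩, ⟨hfs.2, fun _ _ => ⟨rfl, rfl⟩⟩⟩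
end

section
/- Let R be a unital ring, let (P,Q,ψ) be a unital R-system, and let (S,T,σ,B) be a graded, injective and faithful covariant representation of (P,Q,ψ). Then σ(1_R) is a multiplicative identity element of B and σ(1_R) ∈ B_n B_{-n} for every integer n > 0. -/
set_option maxHeartbeats 800000

/-- A covariant representation of a unital `R`-system is faithful if there are finitely many
`qᵢ ∈ Q`, `pᵢ ∈ P` with `Σᵢ θ_{qᵢ,pᵢ} = id_Q` and `σ(1_R) = Σᵢ T(qᵢ) S(pᵢ)`. -/
def CovRep.Faithful {R P Q B : Type*} [Ring R] [AddCommGroup P] [AddCommGroup Q]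
    [NonUnitalRing B] {sys : RSystem R P Q} (rep : CovRep sys B) : Prop :=
  ∃ l : List (Q × P),
    (l.map fun z => theta sys z.1 z.2).sum = (id : Q → Q) ∧
    rep.σ 1 = (l.map fun z => rep.T z.1 * rep.S z.2).sum

theorem map_mem_of_mem_sMul {B : Type*} [NonUnitalRing B] {X Y K : AddSubgroup B} {f : B →+ B}
    (h : ∀ x ∈ X, ∀ y ∈ Y, f (x * y) ∈ K) {z : B} (hz : z ∈ sMul X Y) : f z ∈ K := by
  have hle : sMul X Y ≤ K.comap f := by
    refine (AddSubgroup.closure_le _).2 ?_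
    rintro _ ⟨x, hx, y, hy, rfl⟩
    exact h x hx y hy
  exact hle hz

theorem ZGrading.mul_mul_mem_sMul {B : Type*} [NonUnitalRing B] (G : ZGrading B) {i j k l : ℤ}
    {x z y : B} (hx : x ∈ G.comp k) (hz : z ∈ sMul (G.comp i) (G.comp j))
    (hy : y ∈ G.comp l) : x * z * y ∈ sMul (G.comp (k + i)) (G.comp (j + l)) := by
  refine map_mem_of_mem_sMul (f := (AddMonoidHom.mulRight y).comp (AddMonoidHom.mulLeft x)) ?_ hz
  intro a ha b hb
  exact AddSubgroup.subset_closure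
    ⟨x * a, G.mul_mem hx ha, b * y, G.mul_mem hb hy, by simp [mul_assoc]⟩

theorem GradedCovRep.sigma_one_mul_and_mul_sigma_one
    {R P Q B : Type*} [Ring R] [AddCommGroup P] [AddCommGroup Q] [NonUnitalRing B]
    {sys : RSystem R P Q} (hu : sys.IsUnital) (rep : GradedCovRep sys B) (b : B) :
    rep.σ 1 * b = b ∧ b * rep.σ 1 = b := by
  obtain ⟨hPl, hPr, hQl, hQr⟩ := hu
  have hb : b ∈ NonUnitalSubring.closure
      (Set.range rep.σ ∪ Set.range rep.S ∪ Set.range rep.T) := by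
    rw [rep.surjective]; trivial
  induction hb using NonUnitalSubring.closure_induction with
  | mem x hx =>
    rcases hx with (⟨r, rfl⟩ | ⟨p, rfl⟩) | ⟨q, rfl⟩
    · simp [← rep.σ_mul]
    · rw [← rep.S_lsmul, ← rep.S_rsmul, hPl, hPr]; simp
    · rw [← rep.T_lsmul, ← rep.T_rsmul, hQl, hQr]; simp
  | zero => simp
  | add x y _ _ hx hy => simp [mul_add, add_mul, hx, hy]
  | neg x _ hx => simp [hx]
  | mul x y _ _ hx hy => exact ⟨by rw [← mul_assoc, hx.1], by rw [mul_assoc, hy.2]⟩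

/-- For a graded, injective and faithful covariant representation `(S,T,σ,B)` of a
unital `R`-system, `σ(1_R)` is a multiplicative identity element of `B` and
`σ(1_R) ∈ B_n B_{-n}` for every `n > 0`. -/
theorem sigma_one_mem_of_faithful
    {R P Q B : Type*} [Ring R] [AddCommGroup P] [AddCommGroup Q] [NonUnitalRing B]
    (sys : RSystem R P Q) (hu : sys.IsUnital) (rep : GradedCovRep sys B)
    (hinj : Function.Injective rep.σ) (hfaith : rep.toCovRep.Faithful) :
    (∀ b : B, rep.σ 1 * b = b ∧ b * rep.σ 1 = b) ∧
    ∀ n : ℕ, 0 < n →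
      rep.σ 1 ∈ sMul (rep.grading.comp (n : ℤ)) (rep.grading.comp (-(n : ℤ))) := by
  have hone := rep.sigma_one_mul_and_mul_sigma_one hu
  refine ⟨hone, fun n _ => ?_⟩
  obtain ⟨l, -, hl⟩ := hfaith
  clear * - hone hl
  induction n with
  | zero =>
    exact AddSubgroup.subset_closure
      ⟨rep.σ 1, by simpa using rep.σ_mem 1, rep.σ 1, by simpa using rep.σ_mem 1,
        (hone _).1.symm⟩
  | succ n ih =>
    rw [hl]
    refine AddSubgroup.list_sum_mem _ fun x hx => ?_
    obtain ⟨⟨q, p⟩, -, rfl⟩ := List.mem_map.1 hx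
    have h := rep.grading.mul_mul_mem_sMul (rep.T_mem q) ih (rep.S_mem p)
    rw [(hone _).2] at h
    have h₁ : ((n + 1 : ℕ) : ℤ) = 1 + n := by push_cast; ring
    have h₂ : -(1 + (n : ℤ)) = -n + -1 := by ring
    rwa [h₁, h₂]
end

section
/- Let R be a unital ring and let (P,Q,ψ) be a unital R-system such that ψ is surjective (every element of R is a finite sum of elements ψ(p,q) with p ∈ P, q ∈ Q). Let (S,T,σ,B) be a graded covariant representation of (P,Q,ψ). Then σ(1_R) ∈ B_{-n} B_n for every integer n > 0. -/
set_option maxHeartbeats 800000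

/-- Multiplying `X Y` by `a` on the left and `b` on the right lands in `X' Y'` whenever
`a X ⊆ X'` and `Y b ⊆ Y'`. -/
theorem mul_mul_mem_sMul {B : Type*} [NonUnitalRing B] {X Y X' Y' : AddSubgroup B} {a b z : B}
    (hX : ∀ x ∈ X, a * x ∈ X') (hY : ∀ y ∈ Y, y * b ∈ Y') (hz : z ∈ sMul X Y) :
    a * z * b ∈ sMul X' Y' := by
  refine AddSubgroup.closure_induction (p := fun z _ => a * z * b ∈ sMul X' Y')
    ?_ ?_ ?_ ?_ hz
  · rintro _ ⟨x, hx, y, hy, rfl⟩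
    exact AddSubgroup.subset_closure ⟨a * x, hX x hx, y * b, hY y hy, by simp only [mul_assoc]⟩
  · simp
  · intro u v _ _ hu hv
    simpa only [mul_add, add_mul] using add_mem hu hv
  · intro u _ hu
    simpa only [mul_neg, neg_mul] using neg_mem hu

/-- `σ` as an additive group homomorphism. -/
def CovRep.sigmaHom {R P Q B : Type*} [NonUnitalRing R] [AddCommGroup P] [AddCommGroup Q]
    [NonUnitalRing B] {sys : RSystem R P Q} (rep : CovRep sys B) : R →+ B :=
  AddMonoidHom.mk' rep.σ rep.σ_add

/-- If `P` is right unital and `ψ` is surjective, then `σ(R) ⊆ B_{-n} B_n` for every `n`. -/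
theorem GradedCovRep.sigma_mem_sMul {R P Q B : Type*} [Ring R] [AddCommGroup P]
    [AddCommGroup Q] [NonUnitalRing B] {sys : RSystem R P Q}
    (hP : ∀ p, sys.actP.rsmul p 1 = p)
    (hpsi : ∀ r : R, r ∈ AddSubgroup.closure {x : R | ∃ p q, x = sys.psi p q})
    (rep : GradedCovRep sys B) (n : ℕ) (r : R) :
    rep.σ r ∈ sMul (rep.grading.comp (-(n : ℤ))) (rep.grading.comp (n : ℤ)) := by
  induction n generalizing r with
  | zero =>
    refine AddSubgroup.subset_closure ⟨rep.σ r, ?_, rep.σ 1, ?_, ?_⟩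
    · simpa using rep.σ_mem r
    · simpa using rep.σ_mem 1
    · rw [← rep.σ_mul, mul_one]
  | succ n ih =>
    suffices h : AddSubgroup.closure {x : R | ∃ p q, x = sys.psi p q} ≤
        (sMul (rep.grading.comp (-((n + 1 : ℕ) : ℤ)))
          (rep.grading.comp ((n + 1 : ℕ) : ℤ))).comap rep.sigmaHom from h (hpsi r)
    rw [AddSubgroup.closure_le]
    rintro _ ⟨p, q, rfl⟩
    change rep.σ (sys.psi p q) ∈ sMul _ _
    rw [rep.σ_psi, ← hP p, rep.S_rsmul]
    refine mul_mul_mem_sMul (fun x hx => ?_) (fun y hy => ?_) (ih 1)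
    · have h := rep.grading.mul_mem (rep.S_mem p) hx
      rwa [show (-1 : ℤ) + -(n : ℤ) = -((n + 1 : ℕ) : ℤ) by push_cast; ring] at h
    · exact_mod_cast rep.grading.mul_mem hy (rep.T_mem q)

/-- If `(P,Q,ψ)` is a unital `R`-system with `ψ` surjective (every element of `R`
is a finite sum of elements `ψ(p,q)`), then for any graded covariant representation `(S,T,σ,B)`
we have `σ(1_R) ∈ B_{-n} B_n` for every `n > 0`. -/
theorem sigma_one_mem_of_psi_surjective
    {R P Q B : Type*} [Ring R] [AddCommGroup P] [AddCommGroup Q] [NonUnitalRing B]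
    (sys : RSystem R P Q) (hu : sys.IsUnital)
    (hpsi : ∀ r : R, r ∈ AddSubgroup.closure {x : R | ∃ p q, x = sys.psi p q})
    (rep : GradedCovRep sys B) :
    ∀ n : ℕ, 0 < n →
      rep.σ 1 ∈ sMul (rep.grading.comp (-(n : ℤ))) (rep.grading.comp (n : ℤ)) :=
  fun n _ => rep.sigma_mem_sMul hu.2.1 hpsi n 1
end

section
/- Let R be a unital ring and let (P,Q,ψ) be a unital R-system satisfying Condition (FS'). Let (S,T,σ,B) be an injective graded covariant representation of (P,Q,ψ) which is faithful and such that ψ is surjective (every element of R is a finite sum of elements ψ(p,q)). Then B is strongly ℤ-graded: B_i B_j = B_{i+j} for all i,j ∈ ℤ. -/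
set_option maxHeartbeats 800000

theorem sMul_comp_le {B : Type*} [NonUnitalRing B] (G : ZGrading B) (i j : ℤ) :
    sMul (G.comp i) (G.comp j) ≤ G.comp (i + j) := by
  refine (AddSubgroup.closure_le _).2 ?_
  rintro z ⟨x, hx, y, hy, rfl⟩
  exact G.mul_mem hx hy

/-- If `x ∈ X Y` and every product `v * z` with `v ∈ Y` lies in `W`, then `x * z ∈ X W`. -/
theorem mul_mem_sMul_of_mem_sMul {B : Type*} [NonUnitalRing B] {X Y W : AddSubgroup B} {x z : B}
    (hx : x ∈ sMul X Y) (hz : ∀ v ∈ Y, v * z ∈ W) : x * z ∈ sMul X W := by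
  induction hx using AddSubgroup.closure_induction with
  | mem x hx =>
    obtain ⟨u, hu, v, hv, rfl⟩ := hx
    exact AddSubgroup.subset_closure ⟨u, hu, v * z, hz v hv, mul_assoc u v z⟩
  | zero => simp [zero_mem]
  | add a b _ _ ha hb => rw [add_mul]; exact add_mem ha hb
  | neg a _ ha => rw [neg_mul]; exact neg_mem ha

/-- A left identity lying in `B_k B_{-k}` yields `B_{k+j} ⊆ B_k B_j` for every `j`. -/
theorem comp_add_le_sMul_of_mem_sMul {B : Type*} [NonUnitalRing B] (G : ZGrading B) {e : B}
    (he : ∀ b, e * b = b) {k : ℤ} (hk : e ∈ sMul (G.comp k) (G.comp (-k))) (j : ℤ) :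
    G.comp (k + j) ≤ sMul (G.comp k) (G.comp j) := by
  intro x hx
  rw [← he x]
  refine mul_mem_sMul_of_mem_sMul hk fun v hv => ?_
  simpa using G.mul_mem hv hx

theorem comp_add_le_sMul_add {B : Type*} [NonUnitalRing B] (G : ZGrading B) {k l : ℤ}
    (hk : ∀ j, G.comp (k + j) ≤ sMul (G.comp k) (G.comp j))
    (hl : ∀ j, G.comp (l + j) ≤ sMul (G.comp l) (G.comp j)) (j : ℤ) :
    G.comp (k + l + j) ≤ sMul (G.comp (k + l)) (G.comp j) := by
  intro x hx
  rw [add_assoc] at hx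
  refine (AddSubgroup.closure_le _).2 ?_ (hk _ hx)
  rintro _ ⟨y, hy, z, hz, rfl⟩
  have hz' := hl _ hz
  clear hz
  induction hz' using AddSubgroup.closure_induction with
  | mem z hz =>
    obtain ⟨u, hu, v, hv, rfl⟩ := hz
    exact AddSubgroup.subset_closure ⟨y * u, G.mul_mem hy hu, v, hv, (mul_assoc y u v).symm⟩
  | zero => simp [zero_mem]
  | add a b _ _ ha hb =>
    simp only [SetLike.mem_coe] at ha hb ⊢
    rw [mul_add]; exact add_mem ha hb
  | neg a _ ha =>
    simp only [SetLike.mem_coe] at ha ⊢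
    rw [mul_neg]; exact neg_mem ha

theorem GradedCovRep.σ_one_mul {R P Q B : Type*} [Ring R] [AddCommGroup P] [AddCommGroup Q]
    [NonUnitalRing B] {sys : RSystem R P Q} (hu : sys.IsUnital) (rep : GradedCovRep sys B)
    (b : B) : rep.σ 1 * b = b := by
  have hb : b ∈ NonUnitalSubring.closure
      (Set.range rep.σ ∪ Set.range rep.S ∪ Set.range rep.T) := by
    rw [rep.surjective]; trivial
  induction hb using NonUnitalSubring.closure_induction with
  | mem x hx =>
    rcases hx with (⟨r, rfl⟩ | ⟨p, rfl⟩) | ⟨q, rfl⟩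
    · rw [← rep.σ_mul, one_mul]
    · rw [← rep.S_lsmul, hu.1]
    · rw [← rep.T_lsmul, hu.2.2.1]
  | zero => simp
  | add x y _ _ hx hy => rw [mul_add, hx, hy]
  | neg x _ hx => rw [mul_neg, hx]
  | mul x y _ _ hx _ => rw [← mul_assoc, hx]

theorem GradedCovRep.σ_mem_sMul_of_psi {R P Q B : Type*} [NonUnitalRing R] [AddCommGroup P]
    [AddCommGroup Q] [NonUnitalRing B] {sys : RSystem R P Q} (rep : GradedCovRep sys B) {r : R}
    (hr : r ∈ AddSubgroup.closure {x : R | ∃ p q, x = sys.psi p q}) :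
    rep.σ r ∈ sMul (rep.grading.comp (-1)) (rep.grading.comp 1) := by
  let f : R →+ B := AddMonoidHom.mk' rep.σ rep.σ_add
  suffices h : AddSubgroup.closure {x : R | ∃ p q, x = sys.psi p q} ≤
      (sMul (rep.grading.comp (-1)) (rep.grading.comp 1)).comap f from h hr
  refine (AddSubgroup.closure_le _).2 ?_
  rintro _ ⟨p, q, rfl⟩
  exact AddSubgroup.subset_closure ⟨rep.S p, rep.S_mem p, rep.T q, rep.T_mem q, rep.σ_psi p q⟩

theorem GradedCovRep.σ_one_mem_sMul_of_faithful {R P Q B : Type*} [Ring R] [AddCommGroup P]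
    [AddCommGroup Q] [NonUnitalRing B] {sys : RSystem R P Q} (rep : GradedCovRep sys B)
    (h : rep.toCovRep.Faithful) :
    rep.σ 1 ∈ sMul (rep.grading.comp 1) (rep.grading.comp (-1)) := by
  obtain ⟨l, -, hl⟩ := h
  rw [hl]
  refine AddSubgroup.list_sum_mem _ fun x hx => ?_
  obtain ⟨z, -, rfl⟩ := List.mem_map.1 hx
  exact AddSubgroup.subset_closure ⟨_, rep.T_mem z.1, _, rep.S_mem z.2, rfl⟩

/-- Let `(P,Q,ψ)` be a unital `R`-system satisfying Condition (FS') and let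
`(S,T,σ,B)` be an injective, faithful graded covariant representation with `ψ` surjective.
Then `B` is strongly ℤ-graded: `B_i B_j = B_{i+j}` for all `i, j ∈ ℤ`. -/
theorem strongly_graded_of_faithful_and_psi_surjective
    {R P Q B : Type*} [Ring R] [AddCommGroup P] [AddCommGroup Q] [NonUnitalRing B]
    (sys : RSystem R P Q) (hu : sys.IsUnital) (hfs : CondFS' sys)
    (rep : GradedCovRep sys B)
    (hinj : Function.Injective rep.σ) (hfaith : rep.toCovRep.Faithful)
    (hpsi : ∀ r : R, r ∈ AddSubgroup.closure {x : R | ∃ p q, x = sys.psi p q}) :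
    ∀ i j : ℤ, sMul (rep.grading.comp i) (rep.grading.comp j) = rep.grading.comp (i + j) := by
  intro i j
  have he := rep.σ_one_mul hu
  have hpos := comp_add_le_sMul_of_mem_sMul rep.grading he
    (rep.σ_one_mem_sMul_of_faithful hfaith)
  have hneg := comp_add_le_sMul_of_mem_sMul rep.grading he (k := -1)
    (by simpa using rep.σ_mem_sMul_of_psi (hpsi 1))
  refine le_antisymm (sMul_comp_le _ i j) ?_
  suffices h : ∀ k, rep.grading.comp (i + k) ≤
      sMul (rep.grading.comp i) (rep.grading.comp k) from h j
  induction i using Int.induction_on with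
  | zero =>
    refine comp_add_le_sMul_of_mem_sMul rep.grading he ?_
    exact AddSubgroup.subset_closure
      ⟨_, rep.σ_mem 1, _, by simpa using rep.σ_mem 1, (he _).symm⟩
  | succ n ih => exact comp_add_le_sMul_add _ ih hpos
  | pred n ih => exact comp_add_le_sMul_add _ ih hneg
end

section
/- Let R be a unital ring and let (P,Q,ψ) be a unital R-system satisfying Condition (FS'). Let (S,T,σ,B) be a graded covariant representation of (P,Q,ψ). Then for every integer i ≥ 0 there exists an idempotent ε_i ∈ B_i B_{-i} (with ε₀ = σ(1_R)) such that ε_i s = s for every s ∈ B_i and t ε_i = t for every t ∈ B_{-i}; consequently B_i B_{-i} is a unital ideal of B₀ with multiplicative identity element ε_i. Moreover ε₀ ≥ ε₁ ≥ ε₂ ≥ ⋯ in the idempotent ordering (e ≤ f means ef = fe = e). -/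
set_option maxHeartbeats 800000

/-- The span of the images of all `n`-fold composites of maps in `X`. -/
def iterSpan {A : Type*} [AddCommGroup A] (X : Set (A →+ A)) : ℕ → AddSubgroup A
  | 0 => ⊤
  | n + 1 => AddSubgroup.closure {y | ∃ f ∈ X, ∃ b ∈ iterSpan X n, y = f b}

/-- If `D i ≤ C i` with `C` independent and the `D i` span everything, then `C i ≤ D i`. -/
theorem iSupIndep.le_of_iSup_eq_top {A ι : Type*} [AddCommGroup A]
    {C D : ι → AddSubgroup A} (hC : iSupIndep C) (hDC : ∀ i, D i ≤ C i)
    (hD : ⨆ i, D i = ⊤) (i : ι) : C i ≤ D i := by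
  have h1 : D i ⊔ ⨆ (j) (_ : j ≠ i), C j = ⊤ := by
    rw [eq_top_iff, ← hD]
    refine iSup_le fun j => ?_
    by_cases hj : j = i
    · subst hj
      exact le_sup_left
    · exact ((hDC j).trans (le_iSup₂_of_le j hj le_rfl)).trans le_sup_right
  have h2 := sup_inf_assoc_of_le (⨆ (j) (_ : j ≠ i), C j) (hDC i)
  rw [h1, top_inf_eq, inf_comm, (hC i).eq_bot, sup_bot_eq] at h2
  exact h2.le

/-- In a `ℤ`-graded group generated from a degree-zero element by operators `X₀`, `X₁`, `X₂` of
degrees `0`, `1`, `-1` with `X₀ X₁ ⊆ X₁` and `X₂ X₁ ⊆ X₀`, every element of positive degree lies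
in the span of the images of the operators in `X₁`. -/
theorem mem_closure_of_pos_degree {A : Type*} [AddCommGroup A] (C : ℤ → AddSubgroup A)
    (hC : iSupIndep C) (X₀ X₁ X₂ : Set (A →+ A))
    (h₀ : ∀ f ∈ X₀, ∀ n, ∀ x ∈ C n, f x ∈ C n)
    (h₁ : ∀ f ∈ X₁, ∀ n, ∀ x ∈ C n, f x ∈ C (n + 1))
    (h₂ : ∀ f ∈ X₂, ∀ n, ∀ x ∈ C n, f x ∈ C (n - 1))
    (h₀₁ : ∀ f ∈ X₀, ∀ g ∈ X₁, f.comp g ∈ X₁)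
    (h₂₁ : ∀ f ∈ X₂, ∀ g ∈ X₁, f.comp g ∈ X₀)
    (u : A) (hu : u ∈ C 0)
    (hgen : ∀ H : AddSubgroup A, u ∈ H → (∀ f ∈ X₀, ∀ x ∈ H, f x ∈ H) →
      (∀ f ∈ X₁, ∀ x ∈ H, f x ∈ H) → (∀ f ∈ X₂, ∀ x ∈ H, f x ∈ H) → H = ⊤)
    {n : ℤ} (hn : 1 ≤ n) {s : A} (hs : s ∈ C n) :
    s ∈ AddSubgroup.closure {y | ∃ f ∈ X₁, ∃ b, y = f b} := by
  have hX₀ : ∀ f ∈ X₀, ∀ n, ∀ x ∈ iterSpan X₁ n, f x ∈ iterSpan X₁ n := by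
    intro f hf n x hx
    cases n with
    | zero => trivial
    | succ n =>
      induction hx using AddSubgroup.closure_induction with
      | mem x hx =>
        obtain ⟨g, hg, b, hb, rfl⟩ := hx
        exact AddSubgroup.subset_closure ⟨f.comp g, h₀₁ f hf g hg, b, hb, rfl⟩
      | zero => simp
      | add x y _ _ hx hy => rw [map_add]; exact add_mem hx hy
      | neg x _ hx => rw [map_neg]; exact neg_mem hx
  have hX₂ : ∀ f ∈ X₂, ∀ n, ∀ x ∈ iterSpan X₁ (n + 1), f x ∈ iterSpan X₁ n := by
    intro f hf n x hx
    induction hx using AddSubgroup.closure_induction with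
    | mem x hx =>
      obtain ⟨g, hg, b, hb, rfl⟩ := hx
      exact hX₀ _ (h₂₁ f hf g hg) n b hb
    | zero => simp
    | add x y _ _ hx hy => rw [map_add]; exact add_mem hx hy
    | neg x _ hx => rw [map_neg]; exact neg_mem hx
  let D : ℤ → AddSubgroup A := fun n => C n ⊓ iterSpan X₁ n.toNat
  have hstep : ∀ (f : A →+ A) (k : ℤ), (∀ n, ∀ x ∈ D n, f x ∈ D (n + k)) →
      ∀ x ∈ ⨆ n, D n, f x ∈ ⨆ n, D n := by
    intro f k hf x hx
    induction hx using AddSubgroup.iSup_induction' with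
    | hp n x hx => exact AddSubgroup.mem_iSup_of_mem (n + k) (hf n x hx)
    | h1 => simp
    | hadd x y _ _ hx hy => rw [map_add]; exact add_mem hx hy
  have hD : ⨆ n, D n = ⊤ := by
    refine hgen _ (AddSubgroup.mem_iSup_of_mem 0 ⟨hu, trivial⟩)
      (fun f hf => hstep f 0 ?_) (fun f hf => hstep f 1 ?_) (fun f hf => hstep f (-1) ?_)
    · rintro n x ⟨hx, hx'⟩
      rw [add_zero]
      exact ⟨h₀ f hf n x hx, hX₀ f hf _ x hx'⟩
    · rintro n x ⟨hx, hx'⟩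
      refine ⟨h₁ f hf n x hx, ?_⟩
      rcases le_or_gt 0 n with h | h
      · rw [show (n + 1).toNat = n.toNat + 1 by omega]
        exact AddSubgroup.subset_closure ⟨f, hf, x, hx', rfl⟩
      · rw [show (n + 1).toNat = 0 by omega]
        trivial
    · rintro n x ⟨hx, hx'⟩
      refine ⟨h₂ f hf n x hx, ?_⟩
      rcases le_or_gt 1 n with h | h
      · rw [show n.toNat = (n + -1).toNat + 1 by omega] at hx'
        exact hX₂ f hf _ x hx'
      · rw [show (n + -1).toNat = 0 by omega]
        trivial
  have hsD := (hC.le_of_iSup_eq_top (fun _ => inf_le_left) hD n hs).2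
  rw [show n.toNat = (n.toNat - 1) + 1 by omega] at hsD
  refine AddSubgroup.closure_mono ?_ hsD
  rintro _ ⟨f, hf, b, -, rfl⟩
  exact ⟨f, hf, b, rfl⟩

namespace CovRep

variable {R P Q B : Type*} [Ring R] [AddCommGroup P] [AddCommGroup Q] [NonUnitalRing B]
  {sys : RSystem R P Q} (rep : CovRep sys B)

theorem T_zero : rep.T 0 = 0 := map_zero (AddMonoidHom.mk' rep.T rep.T_add)

theorem T_neg (q : Q) : rep.T (-q) = -rep.T q := map_neg (AddMonoidHom.mk' rep.T rep.T_add) q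

theorem S_zero : rep.S 0 = 0 := map_zero (AddMonoidHom.mk' rep.S rep.S_add)

theorem S_neg (p : P) : rep.S (-p) = -rep.S p := map_neg (AddMonoidHom.mk' rep.S rep.S_add) p

/-- The span of the maps `b ↦ T(q) b S(p)`. -/
def sandwich : AddSubgroup (B →+ B) :=
  AddSubgroup.closure
    {Φ | ∃ q p, Φ = (AddMonoidHom.mulLeft (rep.T q)).comp (AddMonoidHom.mulRight (rep.S p))}

/-- Two additive maps that agree on the maps `b ↦ T(q) b S(p)` agree on their span. -/
theorem sandwich_hom_ext {G : Type*} [AddCommGroup G] {F F' : (B →+ B) →+ G}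
    (h : ∀ q p,
      F ((AddMonoidHom.mulLeft (rep.T q)).comp (AddMonoidHom.mulRight (rep.S p))) =
      F' ((AddMonoidHom.mulLeft (rep.T q)).comp (AddMonoidHom.mulRight (rep.S p))))
    {Φ : B →+ B} (hΦ : Φ ∈ rep.sandwich) : F Φ = F' Φ := by
  refine AddMonoidHom.eqOn_closure (f := F) (g := F') ?_ hΦ
  rintro _ ⟨q, p, rfl⟩
  exact h q p

theorem T_mul_σ_one (hu : sys.IsUnital) (q : Q) : rep.T q * rep.σ 1 = rep.T q := by
  rw [← rep.T_rsmul, hu.2.2.2]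

theorem σ_one_mul_S (hu : sys.IsUnital) (p : P) : rep.σ 1 * rep.S p = rep.S p := by
  rw [← rep.S_lsmul, hu.1]

theorem exists_sandwich_of_mem_FPQ (hu : sys.IsUnital) {f : Q → Q} (hf : f ∈ FPQ sys) :
    ∃ Φ ∈ rep.sandwich, ∀ x, Φ (rep.σ 1) * rep.T x = rep.T (f x) := by
  induction hf using AddSubgroup.closure_induction with
  | mem f hf =>
    obtain ⟨q, p, rfl⟩ := hf
    refine ⟨_, AddSubgroup.subset_closure ⟨q, p, rfl⟩, fun x => ?_⟩
    simp [theta, rep.T_rsmul, rep.σ_psi, rep.σ_one_mul_S hu, mul_assoc]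
  | zero => exact ⟨0, zero_mem _, fun x => by simp [rep.T_zero]⟩
  | add f g _ _ hf hg =>
    obtain ⟨Φ, hΦ, h⟩ := hf
    obtain ⟨Ψ, hΨ, h'⟩ := hg
    exact ⟨Φ + Ψ, add_mem hΦ hΨ, fun x => by simp [add_mul, h, h', rep.T_add]⟩
  | neg f _ hf =>
    obtain ⟨Φ, hΦ, h⟩ := hf
    exact ⟨-Φ, neg_mem hΦ, fun x => by simp [h, rep.T_neg]⟩

theorem exists_sandwich_of_mem_FQP (hu : sys.IsUnital) {f : P → P} (hf : f ∈ FQP sys) :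
    ∃ Φ ∈ rep.sandwich, ∀ y, rep.S y * Φ (rep.σ 1) = rep.S (f y) := by
  induction hf using AddSubgroup.closure_induction with
  | mem f hf =>
    obtain ⟨p, q, rfl⟩ := hf
    refine ⟨_, AddSubgroup.subset_closure ⟨q, p, rfl⟩, fun y => ?_⟩
    simp [thetaOp, rep.S_lsmul, rep.σ_psi, rep.σ_one_mul_S hu, mul_assoc]
  | zero => exact ⟨0, zero_mem _, fun y => by simp [rep.S_zero]⟩
  | add f g _ _ hf hg =>
    obtain ⟨Φ, hΦ, h⟩ := hf
    obtain ⟨Ψ, hΨ, h'⟩ := hg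
    exact ⟨Φ + Ψ, add_mem hΦ hΨ, fun y => by simp [mul_add, h, h', rep.S_add]⟩
  | neg f _ hf =>
    obtain ⟨Φ, hΦ, h⟩ := hf
    exact ⟨-Φ, neg_mem hΦ, fun y => by simp [h, rep.S_neg]⟩

/-- Condition (FS') yields `Φ = ∑ T(qₖ) · S(pₖ)` such that `Φ(σ(1))` is a left identity on `T(Q)`
and a right identity on `S(P)`. -/
theorem exists_sandwich_of_condFS' (hu : sys.IsUnital) (hfs : CondFS' sys) :
    ∃ Φ ∈ rep.sandwich, (∀ q, Φ (rep.σ 1) * rep.T q = rep.T q) ∧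
      ∀ p, rep.S p * Φ (rep.σ 1) = rep.S p := by
  obtain ⟨Φ, hΦ, h⟩ := rep.exists_sandwich_of_mem_FPQ hu hfs.1
  obtain ⟨Ψ, hΨ, h'⟩ := rep.exists_sandwich_of_mem_FQP hu hfs.2
  simp only [id] at h h'
  have hl : Φ (rep.σ 1) * Ψ (rep.σ 1) = Φ (rep.σ 1) :=
    rep.sandwich_hom_ext
      (F := (AddMonoidHom.mulRight (Ψ (rep.σ 1))).comp (AddMonoidHom.eval (rep.σ 1)))
      (F' := AddMonoidHom.eval (rep.σ 1))
      (fun q p => by simp [mul_assoc, h']) hΦ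
  have hr : Φ (rep.σ 1) * Ψ (rep.σ 1) = Ψ (rep.σ 1) :=
    rep.sandwich_hom_ext
      (F := (AddMonoidHom.mulLeft (Φ (rep.σ 1))).comp (AddMonoidHom.eval (rep.σ 1)))
      (F' := AddMonoidHom.eval (rep.σ 1))
      (fun q p => by simp [← mul_assoc, h]) hΨ
  exact ⟨Φ, hΦ, h, fun p => by rw [← hl, hr, h']⟩

end CovRep

namespace GradedCovRep

variable {R P Q B : Type*} [Ring R] [AddCommGroup P] [AddCommGroup Q] [NonUnitalRing B]
  {sys : RSystem R P Q} (rep : GradedCovRep sys B)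

/-- Induction over the generators of the ring `B`. -/
theorem generator_induction {K : B → Prop} (hσ : ∀ r, K (rep.σ r)) (hS : ∀ p, K (rep.S p))
    (hT : ∀ q, K (rep.T q)) (hz : K 0) (ha : ∀ x y, K x → K y → K (x + y))
    (hn : ∀ x, K x → K (-x)) (hm : ∀ x y, K x → K y → K (x * y)) (x : B) : K x := by
  have hx : x ∈ NonUnitalSubring.closure
      (Set.range rep.σ ∪ Set.range rep.S ∪ Set.range rep.T) := by
    rw [rep.surjective]; trivial
  induction hx using NonUnitalSubring.closure_induction with
  | mem x hx =>
    rcases hx with (⟨r, rfl⟩ | ⟨p, rfl⟩) | ⟨q, rfl⟩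
    exacts [hσ r, hS p, hT q]
  | zero => exact hz
  | add x y _ _ hx hy => exact ha x y hx hy
  | neg x _ hx => exact hn x hx
  | mul x y _ _ hx hy => exact hm x y hx hy

theorem σ_one_mul_s10 (hu : sys.IsUnital) (x : B) : rep.σ 1 * x = x := by
  refine rep.generator_induction (K := fun x => rep.σ 1 * x = x) ?_ ?_ ?_ ?_ ?_ ?_ ?_ x
  · intro r; rw [← rep.σ_mul, one_mul]
  · exact rep.σ_one_mul_S hu
  · intro q; rw [← rep.T_lsmul, hu.2.2.1]
  · simp
  · intro x y hx hy; rw [mul_add, hx, hy]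
  · intro x hx; rw [mul_neg, hx]
  · intro x y hx _; rw [← mul_assoc, hx]

theorem mul_σ_one (hu : sys.IsUnital) (x : B) : x * rep.σ 1 = x := by
  refine rep.generator_induction (K := fun x => x * rep.σ 1 = x) ?_ ?_ ?_ ?_ ?_ ?_ ?_ x
  · intro r; rw [← rep.σ_mul, mul_one]
  · intro p; rw [← rep.S_rsmul, hu.2.1]
  · exact rep.T_mul_σ_one hu
  · simp
  · intro x y hx hy; rw [add_mul, hx, hy]
  · intro x hx; rw [neg_mul, hx]
  · intro x y _ hy; rw [mul_assoc, hy]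

/-- Elements of positive degree lie in `T(Q) B`. -/
theorem mem_closure_T_mul (hu : sys.IsUnital) {n : ℤ} (hn : 1 ≤ n) {s : B}
    (hs : s ∈ rep.grading.comp n) :
    s ∈ AddSubgroup.closure {y | ∃ q b, y = rep.T q * b} := by
  have := mem_closure_of_pos_degree rep.grading.comp
    rep.grading.isInternal.addSubgroup_iSupIndep
    (Set.range fun r => AddMonoidHom.mulLeft (rep.σ r))
    (Set.range fun q => AddMonoidHom.mulLeft (rep.T q))
    (Set.range fun p => AddMonoidHom.mulLeft (rep.S p))
    (by
      rintro _ ⟨r, rfl⟩ n x hx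
      simpa using rep.grading.mul_mem (rep.σ_mem r) hx)
    (by
      rintro _ ⟨q, rfl⟩ n x hx
      simpa [add_comm] using rep.grading.mul_mem (rep.T_mem q) hx)
    (by
      rintro _ ⟨p, rfl⟩ n x hx
      simpa [add_comm, sub_eq_add_neg] using rep.grading.mul_mem (rep.S_mem p) hx)
    (by
      rintro _ ⟨r, rfl⟩ _ ⟨q, rfl⟩
      exact ⟨sys.actQ.lsmul r q, by ext; simp [rep.T_lsmul, mul_assoc]⟩)
    (by
      rintro _ ⟨p, rfl⟩ _ ⟨q, rfl⟩
      exact ⟨sys.psi p q, by ext; simp [rep.σ_psi, mul_assoc]⟩)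
    (rep.σ 1) (rep.σ_mem 1)
    (by
      intro H hH hσ hT hS
      refine eq_top_iff.2 fun x _ => ?_
      rw [← rep.mul_σ_one hu x]
      refine rep.generator_induction (K := fun x => ∀ h ∈ H, x * h ∈ H)
        (fun r => hσ _ ⟨r, rfl⟩) (fun p => hS _ ⟨p, rfl⟩) (fun q => hT _ ⟨q, rfl⟩)
        (by simp) ?_ ?_ ?_ x _ hH
      · intro x y hx hy h hh; rw [add_mul]; exact add_mem (hx h hh) (hy h hh)
      · intro x hx h hh; rw [neg_mul]; exact neg_mem (hx h hh)
      · intro x y hx hy h hh; rw [mul_assoc]; exact hx _ (hy h hh))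
    hn hs
  refine AddSubgroup.closure_mono ?_ this
  rintro _ ⟨_, ⟨q, rfl⟩, b, rfl⟩
  exact ⟨q, b, rfl⟩

/-- Elements of negative degree lie in `B S(P)`. -/
theorem mem_closure_mul_S (hu : sys.IsUnital) {n : ℤ} (hn : 1 ≤ n) {t : B}
    (ht : t ∈ rep.grading.comp (-n)) :
    t ∈ AddSubgroup.closure {y | ∃ p b, y = b * rep.S p} := by
  have := mem_closure_of_pos_degree (fun n => rep.grading.comp (-n))
    (rep.grading.isInternal.addSubgroup_iSupIndep.comp neg_injective)
    (Set.range fun r => AddMonoidHom.mulRight (rep.σ r))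
    (Set.range fun p => AddMonoidHom.mulRight (rep.S p))
    (Set.range fun q => AddMonoidHom.mulRight (rep.T q))
    (by
      rintro _ ⟨r, rfl⟩ n x hx
      simpa using rep.grading.mul_mem hx (rep.σ_mem r))
    (by
      rintro _ ⟨p, rfl⟩ n x hx
      simpa [add_comm] using rep.grading.mul_mem hx (rep.S_mem p))
    (by
      rintro _ ⟨q, rfl⟩ n x hx
      simpa [add_comm, sub_eq_add_neg] using rep.grading.mul_mem hx (rep.T_mem q))
    (by
      rintro _ ⟨r, rfl⟩ _ ⟨p, rfl⟩
      exact ⟨sys.actP.rsmul p r, by ext; simp [rep.S_rsmul, mul_assoc]⟩)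
    (by
      rintro _ ⟨q, rfl⟩ _ ⟨p, rfl⟩
      exact ⟨sys.psi p q, by ext; simp [rep.σ_psi, mul_assoc]⟩)
    (rep.σ 1) (by simpa using rep.σ_mem 1)
    (by
      intro H hH hσ hS hT
      refine eq_top_iff.2 fun x _ => ?_
      rw [← rep.σ_one_mul_s10 hu x]
      refine rep.generator_induction (K := fun x => ∀ h ∈ H, h * x ∈ H)
        (fun r => hσ _ ⟨r, rfl⟩) (fun p => hS _ ⟨p, rfl⟩) (fun q => hT _ ⟨q, rfl⟩)
        (by simp) ?_ ?_ ?_ x _ hH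
      · intro x y hx hy h hh; rw [mul_add]; exact add_mem (hx h hh) (hy h hh)
      · intro x hx h hh; rw [mul_neg]; exact neg_mem (hx h hh)
      · intro x y hx hy h hh; rw [← mul_assoc]; exact hy _ (hx h hh))
    hn ht
  refine AddSubgroup.closure_mono ?_ this
  rintro _ ⟨_, ⟨p, rfl⟩, b, rfl⟩
  exact ⟨p, b, rfl⟩

theorem mul_eq_self_of_pos_degree (hu : sys.IsUnital) {e : B}
    (he : ∀ q, e * rep.T q = rep.T q) {n : ℤ} (hn : 1 ≤ n) {s : B}
    (hs : s ∈ rep.grading.comp n) : e * s = s := by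
  refine AddMonoidHom.eqOn_closure (f := AddMonoidHom.mulLeft e) (g := AddMonoidHom.id B)
    ?_ (rep.mem_closure_T_mul hu hn hs)
  rintro _ ⟨q, b, rfl⟩
  simp [← mul_assoc, he]

theorem mul_eq_self_of_neg_degree (hu : sys.IsUnital) {e : B}
    (he : ∀ p, rep.S p * e = rep.S p) {n : ℤ} (hn : 1 ≤ n) {t : B}
    (ht : t ∈ rep.grading.comp (-n)) : t * e = t := by
  refine AddMonoidHom.eqOn_closure (f := AddMonoidHom.mulRight e) (g := AddMonoidHom.id B)
    ?_ (rep.mem_closure_mul_S hu hn ht)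
  rintro _ ⟨p, b, rfl⟩
  simp [mul_assoc, he]

theorem sandwich_mem_sMul {Φ : B →+ B} (hΦ : Φ ∈ rep.sandwich) {i : ℤ} {x : B}
    (hx : x ∈ sMul (rep.grading.comp i) (rep.grading.comp (-i))) :
    Φ x ∈ sMul (rep.grading.comp (i + 1)) (rep.grading.comp (-(i + 1))) := by
  induction hx using AddSubgroup.closure_induction with
  | mem x hx =>
    obtain ⟨a, ha, b, hb, rfl⟩ := hx
    induction hΦ using AddSubgroup.closure_induction with
    | mem Φ hΦ =>
      obtain ⟨q, p, rfl⟩ := hΦ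
      refine AddSubgroup.subset_closure ⟨rep.T q * a, ?_, b * rep.S p, ?_, by simp [mul_assoc]⟩
      · simpa [add_comm] using rep.grading.mul_mem (rep.T_mem q) ha
      · simpa [add_comm] using rep.grading.mul_mem hb (rep.S_mem p)
    | zero => exact zero_mem _
    | add Φ Ψ _ _ h h' => exact add_mem h h'
    | neg Φ _ h => exact neg_mem h
  | zero => simp
  | add x y _ _ hx hy => rw [map_add]; exact add_mem hx hy
  | neg x _ hx => rw [map_neg]; exact neg_mem hx

theorem sandwich_mul_eq (hu : sys.IsUnital) {Φ : B →+ B} (hΦ : Φ ∈ rep.sandwich) {n : ℤ}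
    {ε s : B} (hε : ∀ x ∈ rep.grading.comp (n - 1), ε * x = x) (hs : s ∈ rep.grading.comp n) :
    Φ ε * s = Φ (rep.σ 1) * s := by
  refine rep.sandwich_hom_ext
    (F := (AddMonoidHom.mulRight s).comp (AddMonoidHom.eval ε))
    (F' := (AddMonoidHom.mulRight s).comp (AddMonoidHom.eval (rep.σ 1))) (fun q p => ?_) hΦ
  have := hε (rep.S p * s)
    (by simpa [add_comm, sub_eq_add_neg] using rep.grading.mul_mem (rep.S_mem p) hs)
  simp [mul_assoc, this, rep.σ_one_mul_s10 hu]

theorem mul_sandwich_eq (hu : sys.IsUnital) {Φ : B →+ B} (hΦ : Φ ∈ rep.sandwich) {n : ℤ}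
    {ε t : B} (hε : ∀ x ∈ rep.grading.comp (-(n - 1)), x * ε = x)
    (ht : t ∈ rep.grading.comp (-n)) :
    t * Φ ε = t * Φ (rep.σ 1) := by
  refine rep.sandwich_hom_ext
    (F := (AddMonoidHom.mulLeft t).comp (AddMonoidHom.eval ε))
    (F' := (AddMonoidHom.mulLeft t).comp (AddMonoidHom.eval (rep.σ 1))) (fun q p => ?_) hΦ
  have := hε (t * rep.T q)
    (by simpa [add_comm, sub_eq_add_neg] using rep.grading.mul_mem ht (rep.T_mem q))
  simp [← mul_assoc, this, rep.mul_σ_one hu]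

end GradedCovRep

theorem mul_eq_self_of_mem_sMul {B : Type*} [NonUnitalRing B] {X Y : AddSubgroup B} {e x : B}
    (he : ∀ s ∈ X, e * s = s) (hx : x ∈ sMul X Y) : e * x = x := by
  refine AddMonoidHom.eqOn_closure (f := AddMonoidHom.mulLeft e) (g := AddMonoidHom.id B) ?_ hx
  rintro _ ⟨a, ha, b, -, rfl⟩
  simp [← mul_assoc, he a ha]

theorem mul_eq_self_of_mem_sMul_right {B : Type*} [NonUnitalRing B] {X Y : AddSubgroup B}
    {e x : B} (he : ∀ t ∈ Y, t * e = t) (hx : x ∈ sMul X Y) : x * e = x := by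
  refine AddMonoidHom.eqOn_closure (f := AddMonoidHom.mulRight e) (g := AddMonoidHom.id B) ?_ hx
  rintro _ ⟨a, -, b, hb, rfl⟩
  simp [mul_assoc, he b hb]

/-- For a graded covariant representation `(S,T,σ,B)` of a unital `R`-system
satisfying Condition (FS'), there is for every `i ≥ 0` an idempotent `ε_i ∈ B_i B_{-i}`
(with `ε₀ = σ(1_R)`) which is a left identity on `B_i`, a right identity on `B_{-i}`, and a
multiplicative identity of `B_i B_{-i}`; moreover `ε₀ ≥ ε₁ ≥ ε₂ ≥ ⋯` in the idempotent
ordering. -/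
theorem exists_idempotent_sequence_of_condFS'
    {R P Q B : Type*} [Ring R] [AddCommGroup P] [AddCommGroup Q] [NonUnitalRing B]
    (sys : RSystem R P Q) (hu : sys.IsUnital) (hfs : CondFS' sys)
    (rep : GradedCovRep sys B) :
    ∃ ε : ℕ → B,
      ε 0 = rep.σ 1 ∧
      (∀ i : ℕ, ε i ∈ sMul (rep.grading.comp (i : ℤ)) (rep.grading.comp (-(i : ℤ)))) ∧
      (∀ i : ℕ, ε i * ε i = ε i) ∧
      (∀ i : ℕ, ∀ s ∈ rep.grading.comp (i : ℤ), ε i * s = s) ∧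
      (∀ i : ℕ, ∀ t ∈ rep.grading.comp (-(i : ℤ)), t * ε i = t) ∧
      (∀ i : ℕ, ∀ x ∈ sMul (rep.grading.comp (i : ℤ)) (rep.grading.comp (-(i : ℤ))),
        ε i * x = x ∧ x * ε i = x) ∧
      (∀ i : ℕ, ε (i + 1) * ε i = ε (i + 1) ∧ ε i * ε (i + 1) = ε (i + 1)) := by
  obtain ⟨Φ, hΦ, hT, hS⟩ := rep.exists_sandwich_of_condFS' hu hfs
  let ε : ℕ → B := fun i => Φ^[i] (rep.σ 1)
  have hsucc : ∀ i, ε (i + 1) = Φ (ε i) := fun i => Function.iterate_succ_apply' _ _ _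
  have hmem : ∀ i : ℕ,
      ε i ∈ sMul (rep.grading.comp (i : ℤ)) (rep.grading.comp (-(i : ℤ))) := by
    intro i
    induction i with
    | zero =>
      exact AddSubgroup.subset_closure ⟨rep.σ 1, by simpa using rep.σ_mem 1, rep.σ 1,
        by simpa using rep.σ_mem 1, (rep.σ_one_mul_s10 hu _).symm⟩
    | succ i ih =>
      rw [hsucc]
      exact_mod_cast rep.sandwich_mem_sMul hΦ ih
  have hleft : ∀ (i : ℕ) (n : ℤ), (i : ℤ) ≤ n → ∀ s ∈ rep.grading.comp n, ε i * s = s := by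
    intro i
    induction i with
    | zero => exact fun _ _ s _ => rep.σ_one_mul_s10 hu s
    | succ i ih =>
      intro n hn s hs
      push_cast at hn
      rw [hsucc, rep.sandwich_mul_eq hu hΦ (ih (n - 1) (by omega)) hs]
      exact rep.mul_eq_self_of_pos_degree hu hT (by omega) hs
  have hright : ∀ (i : ℕ) (n : ℤ), (i : ℤ) ≤ n → ∀ t ∈ rep.grading.comp (-n), t * ε i = t := by
    intro i
    induction i with
    | zero => exact fun _ _ t _ => rep.mul_σ_one hu t
    | succ i ih =>
      intro n hn t ht
      push_cast at hn
      rw [hsucc, rep.mul_sandwich_eq hu hΦ (ih (n - 1) (by omega)) ht]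
      exact rep.mul_eq_self_of_neg_degree hu hS (by omega) ht
  exact ⟨ε, rfl, hmem, fun i => mul_eq_self_of_mem_sMul (hleft i i le_rfl) (hmem i),
    fun i => hleft i i le_rfl, fun i => hright i i le_rfl,
    fun i x hx => ⟨mul_eq_self_of_mem_sMul (hleft i i le_rfl) hx,
      mul_eq_self_of_mem_sMul_right (hright i i le_rfl) hx⟩,
    fun i => ⟨mul_eq_self_of_mem_sMul_right (hright i _ (by simp)) (hmem (i + 1)),
      mul_eq_self_of_mem_sMul (hleft i _ (by simp)) (hmem (i + 1))⟩⟩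
end

section
/- Let R be an s-unital (not necessarily unital) ring and let (P,Q,ψ) be an s-unital R-system satisfying Condition (FS). Let (S,T,σ,B) be a graded covariant representation of (P,Q,ψ). Then: (a) for every i ≥ 0 and every s ∈ B_i there exists ε ∈ B_i B_{-i} with εs = s; (b) for every i ≥ 0 and every t ∈ B_{-i} there exists ε ∈ B_i B_{-i} with tε = t; (c) B_i B_{-i} is an s-unital ring for every i ≥ 0; (d) B_i = B_i B_{-i} B_i for every i ∈ ℤ (i.e. B is symmetrically ℤ-graded). -/
set_option maxHeartbeats 800000

/-- An element of the span of `X * Y` is fixed by every `e` fixing suitable finitely many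
elements of `X` from the left. -/
theorem exists_list_left {B : Type*} [NonUnitalRing B] {X Y : Set B} {x : B}
    (hx : x ∈ AddSubgroup.closure {z : B | ∃ a ∈ X, ∃ b ∈ Y, z = a * b}) :
    ∃ L : List B, (∀ a ∈ L, a ∈ X) ∧ ∀ e : B, (∀ a ∈ L, e * a = a) → e * x = x := by
  induction hx using AddSubgroup.closure_induction with
  | mem z hz =>
    obtain ⟨a, ha, b, -, rfl⟩ := hz
    exact ⟨[a], by simpa using ha, fun e he => by rw [← mul_assoc, he a (by simp)]⟩
  | zero => exact ⟨[], by simp, fun e _ => mul_zero e⟩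
  | add x y _ _ hx hy =>
    obtain ⟨L, hL, hLe⟩ := hx
    obtain ⟨M, hM, hMe⟩ := hy
    refine ⟨L ++ M, fun a ha => (List.mem_append.1 ha).elim (hL a) (hM a), fun e he => ?_⟩
    rw [mul_add, hLe e fun a ha => he a (List.mem_append_left _ ha),
      hMe e fun a ha => he a (List.mem_append_right _ ha)]
  | neg x _ hx =>
    obtain ⟨L, hL, hLe⟩ := hx
    exact ⟨L, hL, fun e he => by rw [mul_neg, hLe e he]⟩

/-- An element of the span of `X * Y` is fixed by every `e` fixing suitable finitely many
elements of `Y` from the right. -/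
theorem exists_list_right {B : Type*} [NonUnitalRing B] {X Y : Set B} {x : B}
    (hx : x ∈ AddSubgroup.closure {z : B | ∃ a ∈ X, ∃ b ∈ Y, z = a * b}) :
    ∃ L : List B, (∀ b ∈ L, b ∈ Y) ∧ ∀ e : B, (∀ b ∈ L, b * e = b) → x * e = x := by
  induction hx using AddSubgroup.closure_induction with
  | mem z hz =>
    obtain ⟨a, -, b, hb, rfl⟩ := hz
    exact ⟨[b], by simpa using hb, fun e he => by rw [mul_assoc, he b (by simp)]⟩
  | zero => exact ⟨[], by simp, fun e _ => zero_mul e⟩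
  | add x y _ _ hx hy =>
    obtain ⟨L, hL, hLe⟩ := hx
    obtain ⟨M, hM, hMe⟩ := hy
    refine ⟨L ++ M, fun a ha => (List.mem_append.1 ha).elim (hL a) (hM a), fun e he => ?_⟩
    rw [add_mul, hLe e fun a ha => he a (List.mem_append_left _ ha),
      hMe e fun a ha => he a (List.mem_append_right _ ha)]
  | neg x _ hx =>
    obtain ⟨L, hL, hLe⟩ := hx
    exact ⟨L, hL, fun e he => by rw [neg_mul, hLe e he]⟩

/-- The version of `exists_list_left` for finitely many elements of the span. -/
theorem exists_list_left_of_list {B : Type*} [NonUnitalRing B] {X Y : Set B} (K : List B)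
    (hK : ∀ x ∈ K, x ∈ AddSubgroup.closure {z : B | ∃ a ∈ X, ∃ b ∈ Y, z = a * b}) :
    ∃ L : List B, (∀ a ∈ L, a ∈ X) ∧
      ∀ e : B, (∀ a ∈ L, e * a = a) → ∀ x ∈ K, e * x = x := by
  induction K with
  | nil => exact ⟨[], by simp, by simp⟩
  | cons x K ih =>
    obtain ⟨L, hL, hLe⟩ := ih fun y hy => hK y (List.mem_cons_of_mem _ hy)
    obtain ⟨M, hM, hMe⟩ := exists_list_left (hK x List.mem_cons_self)
    refine ⟨L ++ M, fun a ha => (List.mem_append.1 ha).elim (hL a) (hM a), fun e he y hy => ?_⟩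
    rcases List.mem_cons.1 hy with rfl | hy
    · exact hMe e fun a ha => he a (List.mem_append_right _ ha)
    · exact hLe e (fun a ha => he a (List.mem_append_left _ ha)) y hy

/-- The version of `exists_list_right` for finitely many elements of the span. -/
theorem exists_list_right_of_list {B : Type*} [NonUnitalRing B] {X Y : Set B} (K : List B)
    (hK : ∀ x ∈ K, x ∈ AddSubgroup.closure {z : B | ∃ a ∈ X, ∃ b ∈ Y, z = a * b}) :
    ∃ L : List B, (∀ b ∈ L, b ∈ Y) ∧
      ∀ e : B, (∀ b ∈ L, b * e = b) → ∀ x ∈ K, x * e = x := by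
  induction K with
  | nil => exact ⟨[], by simp, by simp⟩
  | cons x K ih =>
    obtain ⟨L, hL, hLe⟩ := ih fun y hy => hK y (List.mem_cons_of_mem _ hy)
    obtain ⟨M, hM, hMe⟩ := exists_list_right (hK x List.mem_cons_self)
    refine ⟨L ++ M, fun a ha => (List.mem_append.1 ha).elim (hL a) (hM a), fun e he y hy => ?_⟩
    rcases List.mem_cons.1 hy with rfl | hy
    · exact hMe e fun a ha => he a (List.mem_append_right _ ha)
    · exact hLe e (fun a ha => he a (List.mem_append_left _ ha)) y hy

namespace ZGrading

variable {B : Type*} [NonUnitalRing B] (G : ZGrading B)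

theorem mul_mem_of_eq {i j k : ℤ} {x y : B} (hx : x ∈ G.comp i) (hy : y ∈ G.comp j)
    (h : i + j = k) : x * y ∈ G.comp k :=
  h ▸ G.mul_mem hx hy

/-- If `B` is spanned by homogeneous elements satisfying a graded predicate `W`, then each
component is spanned by the elements satisfying `W` in that degree. -/
theorem comp_le_closure (W : ℤ → B → Prop) (hW : ∀ i b, W i b → b ∈ G.comp i)
    (hspan : AddSubgroup.closure {b | ∃ i, W i b} = ⊤) (i : ℤ) :
    G.comp i ≤ AddSubgroup.closure {b | W i b} := by
  classical
  let := G.isInternal.chooseDecomposition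
  have key : ∀ x : B, (DirectSum.decompose G.comp x i : B) ∈
      AddSubgroup.closure {b | W i b} := by
    intro x
    have hx : x ∈ AddSubgroup.closure {b | ∃ i, W i b} := hspan ▸ AddSubgroup.mem_top x
    induction hx using AddSubgroup.closure_induction with
    | mem x hx =>
      obtain ⟨j, hj⟩ := hx
      by_cases hij : j = i
      · subst hij
        rw [DirectSum.decompose_of_mem_same _ (hW _ _ hj)]
        exact AddSubgroup.subset_closure hj
      · rw [DirectSum.decompose_of_mem_ne _ (hW _ _ hj) hij]
        exact zero_mem _
    | zero => simp
    | add x y _ _ hx hy =>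
      rw [DirectSum.decompose_add]
      exact add_mem hx hy
    | neg x _ hx =>
      rw [DirectSum.decompose_neg]
      exact neg_mem hx
  intro x hx
  rw [← DirectSum.decompose_of_mem_same G.comp hx]
  exact key x

theorem sMul_conj_mem {i : ℤ} {a b e : B} (ha : a ∈ G.comp 1) (hb : b ∈ G.comp (-1))
    (he : e ∈ sMul (G.comp i) (G.comp (-i))) :
    a * e * b ∈ sMul (G.comp (i + 1)) (G.comp (-(i + 1))) := by
  induction he using AddSubgroup.closure_induction with
  | mem z hz =>
    obtain ⟨x, hx, y, hy, rfl⟩ := hz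
    rw [← mul_assoc, mul_assoc (a * x)]
    exact mul_mem_sMul (G.mul_mem_of_eq ha hx (by ring)) (G.mul_mem_of_eq hy hb (by ring))
  | zero => simp
  | add x y _ _ hx hy =>
    rw [mul_add, add_mul]
    exact add_mem hx hy
  | neg x _ hx =>
    rw [mul_neg, neg_mul]
    exact neg_mem hx

/-- Every finite subset of `B_i` has a common left unit in `B_i B_{-i}`. -/
def HasLeftUnits (i : ℤ) : Prop :=
  ∀ L : List B, (∀ s ∈ L, s ∈ G.comp i) →
    ∃ e ∈ sMul (G.comp i) (G.comp (-i)), ∀ s ∈ L, e * s = s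

/-- Every finite subset of `B_{-i}` has a common right unit in `B_i B_{-i}`. -/
def HasRightUnits (i : ℤ) : Prop :=
  ∀ L : List B, (∀ t ∈ L, t ∈ G.comp (-i)) →
    ∃ e ∈ sMul (G.comp i) (G.comp (-i)), ∀ t ∈ L, t * e = t

variable {G}

theorem HasLeftUnits.exists_mul_eq {i : ℤ} (h : G.HasLeftUnits i) {X Y : Set B}
    (hX : ∀ a ∈ X, a ∈ G.comp 1) (hY : ∀ b ∈ Y, b ∈ G.comp (-1)) {L : List B}
    (hL : ∀ s ∈ L, s ∈ G.comp (i + 1)) {e : B}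
    (he : e ∈ AddSubgroup.closure {z : B | ∃ a ∈ X, ∃ b ∈ Y, z = a * b}) :
    ∃ e' ∈ sMul (G.comp (i + 1)) (G.comp (-(i + 1))), ∀ s ∈ L, e' * s = e * s := by
  induction he using AddSubgroup.closure_induction with
  | mem z hz =>
    obtain ⟨a, ha, b, hb, rfl⟩ := hz
    obtain ⟨f, hf, hfs⟩ := h (L.map (b * ·)) <| by
      intro s hs
      obtain ⟨t, ht, rfl⟩ := List.mem_map.1 hs
      exact G.mul_mem_of_eq (hY b hb) (hL t ht) (by ring)
    refine ⟨a * f * b, G.sMul_conj_mem (hX a ha) (hY b hb) hf, fun s hs => ?_⟩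
    rw [mul_assoc, mul_assoc, hfs _ (List.mem_map_of_mem hs), mul_assoc]
  | zero => exact ⟨0, zero_mem _, fun _ _ => rfl⟩
  | add x y _ _ hx hy =>
    obtain ⟨f, hf, hfs⟩ := hx
    obtain ⟨g, hg, hgs⟩ := hy
    exact ⟨f + g, add_mem hf hg, fun s hs => by rw [add_mul, add_mul, hfs s hs, hgs s hs]⟩
  | neg x _ hx =>
    obtain ⟨f, hf, hfs⟩ := hx
    exact ⟨-f, neg_mem hf, fun s hs => by rw [neg_mul, neg_mul, hfs s hs]⟩

theorem HasRightUnits.exists_mul_eq {i : ℤ} (h : G.HasRightUnits i) {X Y : Set B}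
    (hX : ∀ a ∈ X, a ∈ G.comp 1) (hY : ∀ b ∈ Y, b ∈ G.comp (-1)) {L : List B}
    (hL : ∀ t ∈ L, t ∈ G.comp (-(i + 1))) {e : B}
    (he : e ∈ AddSubgroup.closure {z : B | ∃ a ∈ X, ∃ b ∈ Y, z = a * b}) :
    ∃ e' ∈ sMul (G.comp (i + 1)) (G.comp (-(i + 1))), ∀ t ∈ L, t * e' = t * e := by
  induction he using AddSubgroup.closure_induction with
  | mem z hz =>
    obtain ⟨a, ha, b, hb, rfl⟩ := hz
    obtain ⟨f, hf, hfs⟩ := h (L.map (· * a)) <| by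
      intro s hs
      obtain ⟨t, ht, rfl⟩ := List.mem_map.1 hs
      exact G.mul_mem_of_eq (hL t ht) (hX a ha) (by ring)
    refine ⟨a * f * b, G.sMul_conj_mem (hX a ha) (hY b hb) hf, fun s hs => ?_⟩
    rw [← mul_assoc, ← mul_assoc, hfs _ (List.mem_map_of_mem hs), mul_assoc]
  | zero => exact ⟨0, zero_mem _, fun _ _ => rfl⟩
  | add x y _ _ hx hy =>
    obtain ⟨f, hf, hfs⟩ := hx
    obtain ⟨g, hg, hgs⟩ := hy
    exact ⟨f + g, add_mem hf hg, fun s hs => by rw [mul_add, mul_add, hfs s hs, hgs s hs]⟩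
  | neg x _ hx =>
    obtain ⟨f, hf, hfs⟩ := hx
    exact ⟨-f, neg_mem hf, fun s hs => by rw [mul_neg, mul_neg, hfs s hs]⟩

theorem sMul_sMul_le (i : ℤ) :
    sMul (sMul (G.comp i) (G.comp (-i))) (G.comp i) ≤ G.comp i := by
  have h : sMul (G.comp i) (G.comp (-i)) ≤ G.comp 0 :=
    sMul_le fun x hx y hy => G.mul_mem_of_eq hx hy (by ring)
  exact sMul_le fun x hx y hy => G.mul_mem_of_eq (h hx) hy (by ring)

theorem HasLeftUnits.sMul_sMul_eq {i : ℤ} (h : G.HasLeftUnits i) :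
    sMul (sMul (G.comp i) (G.comp (-i))) (G.comp i) = G.comp i := by
  refine le_antisymm (sMul_sMul_le i) fun s hs => ?_
  obtain ⟨e, he, hes⟩ := h [s] (by simpa using hs)
  rw [← hes s (by simp)]
  exact mul_mem_sMul he hs

theorem HasRightUnits.sMul_sMul_eq {i : ℤ} (h : G.HasRightUnits i) :
    sMul (sMul (G.comp (-i)) (G.comp i)) (G.comp (-i)) = G.comp (-i) := by
  refine le_antisymm (by simpa using sMul_sMul_le (G := G) (-i)) fun t ht => ?_
  obtain ⟨e, he, het⟩ := h [t] (by simpa using ht)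
  rw [← het t (by simp)]
  clear het
  induction he using AddSubgroup.closure_induction with
  | mem z hz =>
    obtain ⟨x, hx, y, hy, rfl⟩ := hz
    rw [← mul_assoc]
    exact mul_mem_sMul (mul_mem_sMul ht hx) hy
  | zero => simp
  | add x y _ _ hx hy =>
    rw [mul_add]
    exact add_mem hx hy
  | neg x _ hx =>
    rw [mul_neg]
    exact neg_mem hx

end ZGrading

namespace CovRep

variable {R P Q B : Type*} [NonUnitalRing R] [AddCommGroup P] [AddCommGroup Q]
  [NonUnitalRing B] {sys : RSystem R P Q} (rep : CovRep sys B)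

theorem map_σ_sub (r r' : R) : rep.σ (r - r') = rep.σ r - rep.σ r' :=
  (AddMonoidHom.mk' rep.σ rep.σ_add).map_sub r r'

/-- `Θ ∈ F_P(Q)` is implemented on `T(Q)` by left multiplication with an element of the span of
`T(Q) S(P)`. -/
theorem exists_mul_T_eq {Θ : Q → Q} (hΘ : Θ ∈ FPQ sys) :
    ∃ e ∈ AddSubgroup.closure
      {z : B | ∃ a ∈ Set.range rep.T, ∃ b ∈ Set.range rep.S, z = a * b},
      ∀ q, e * rep.T q = rep.T (Θ q) := by
  induction hΘ using AddSubgroup.closure_induction with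
  | mem f hf =>
    obtain ⟨q, p, rfl⟩ := hf
    refine ⟨rep.T q * rep.S p,
      AddSubgroup.subset_closure ⟨_, ⟨q, rfl⟩, _, ⟨p, rfl⟩, rfl⟩, fun x => ?_⟩
    rw [theta, rep.T_rsmul, rep.σ_psi, mul_assoc]
  | zero =>
    exact ⟨0, zero_mem _, fun q => by
      simpa using (AddMonoidHom.mk' rep.T rep.T_add).map_zero.symm⟩
  | add f g _ _ hf hg =>
    obtain ⟨e, he, heq⟩ := hf
    obtain ⟨e', he', heq'⟩ := hg
    exact ⟨e + e', add_mem he he', fun q => by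
      rw [add_mul, heq, heq', Pi.add_apply, rep.T_add]⟩
  | neg f _ hf =>
    obtain ⟨e, he, heq⟩ := hf
    exact ⟨-e, neg_mem he, fun q => by
      rw [neg_mul, heq, Pi.neg_apply]
      exact ((AddMonoidHom.mk' rep.T rep.T_add).map_neg (f q)).symm⟩

/-- `Φ ∈ F_Q(P)` is implemented on `S(P)` by right multiplication with an element of the span of
`T(Q) S(P)`. -/
theorem exists_S_mul_eq {Φ : P → P} (hΦ : Φ ∈ FQP sys) :
    ∃ e ∈ AddSubgroup.closure
      {z : B | ∃ a ∈ Set.range rep.T, ∃ b ∈ Set.range rep.S, z = a * b},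
      ∀ p, rep.S p * e = rep.S (Φ p) := by
  induction hΦ using AddSubgroup.closure_induction with
  | mem f hf =>
    obtain ⟨p, q, rfl⟩ := hf
    refine ⟨rep.T q * rep.S p,
      AddSubgroup.subset_closure ⟨_, ⟨q, rfl⟩, _, ⟨p, rfl⟩, rfl⟩, fun x => ?_⟩
    rw [thetaOp, rep.S_lsmul, rep.σ_psi, mul_assoc]
  | zero =>
    exact ⟨0, zero_mem _, fun q => by
      simpa using (AddMonoidHom.mk' rep.S rep.S_add).map_zero.symm⟩
  | add f g _ _ hf hg =>
    obtain ⟨e, he, heq⟩ := hf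
    obtain ⟨e', he', heq'⟩ := hg
    exact ⟨e + e', add_mem he he', fun q => by
      rw [mul_add, heq, heq', Pi.add_apply, rep.S_add]⟩
  | neg f _ hf =>
    obtain ⟨e, he, heq⟩ := hf
    exact ⟨-e, neg_mem he, fun q => by
      rw [mul_neg, heq, Pi.neg_apply]
      exact ((AddMonoidHom.mk' rep.S rep.S_add).map_neg (f q)).symm⟩

/-- Under Condition (FS), finitely many elements of `T(Q)` have a common left unit in the span of
`T(Q) S(P)`. -/
theorem exists_left_unit_of_condFS (hfs : CondFS sys) (L : List B)
    (hL : ∀ a ∈ L, a ∈ Set.range rep.T) :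
    ∃ e ∈ AddSubgroup.closure
      {z : B | ∃ a ∈ Set.range rep.T, ∃ b ∈ Set.range rep.S, z = a * b},
      ∀ a ∈ L, e * a = a := by
  obtain ⟨qs, rfl⟩ : ∃ qs : List Q, qs.map rep.T = L := by
    simpa using (Set.mem_range (f := List.map rep.T)).1 (by rw [Set.range_list_map]; exact hL)
  obtain ⟨Θ, hΘ, -, -, hq, -⟩ := hfs qs []
  obtain ⟨e, he, heq⟩ := rep.exists_mul_T_eq hΘ
  refine ⟨e, he, fun a ha => ?_⟩
  obtain ⟨q, hqs, rfl⟩ := List.mem_map.1 ha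
  rw [heq, hq q hqs]

/-- Under Condition (FS), finitely many elements of `S(P)` have a common right unit in the span of
`T(Q) S(P)`. -/
theorem exists_right_unit_of_condFS (hfs : CondFS sys) (L : List B)
    (hL : ∀ b ∈ L, b ∈ Set.range rep.S) :
    ∃ e ∈ AddSubgroup.closure
      {z : B | ∃ a ∈ Set.range rep.T, ∃ b ∈ Set.range rep.S, z = a * b},
      ∀ b ∈ L, b * e = b := by
  obtain ⟨ps, rfl⟩ : ∃ ps : List P, ps.map rep.S = L := by
    simpa using (Set.mem_range (f := List.map rep.S)).1 (by rw [Set.range_list_map]; exact hL)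
  obtain ⟨-, -, Φ, hΦ, -, hp⟩ := hfs [] ps
  obtain ⟨e, he, heq⟩ := rep.exists_S_mul_eq hΦ
  refine ⟨e, he, fun a ha => ?_⟩
  obtain ⟨p, hps, rfl⟩ := List.mem_map.1 ha
  rw [heq, hp p hps]

theorem exists_common_left_unit (hR : IsSUnitalRing R) (u w : R) :
    ∃ z : R, (∀ x, rep.σ u * x = x → rep.σ z * x = x) ∧
      ∀ x, rep.σ w * x = x → rep.σ z * x = x := by
  obtain ⟨v, hv⟩ := (hR (w - u * w)).1
  have hz : ∀ x, rep.σ (v + u - v * u) * x =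
      rep.σ v * (x - rep.σ u * x) + rep.σ u * x := by
    intro x
    rw [map_σ_sub, rep.σ_add, rep.σ_mul]
    noncomm_ring
  refine ⟨v + u - v * u, fun x hx => ?_, fun x hx => ?_⟩
  · rw [hz, hx, sub_self, mul_zero, zero_add]
  · have h : rep.σ (w - u * w) * x = x - rep.σ u * x := by
      rw [map_σ_sub, rep.σ_mul, sub_mul, mul_assoc, hx]
    rw [hz, ← h, ← mul_assoc, ← rep.σ_mul, hv, h, sub_add_cancel]

theorem exists_common_right_unit (hR : IsSUnitalRing R) (u w : R) :
    ∃ z : R, (∀ x, x * rep.σ u = x → x * rep.σ z = x) ∧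
      ∀ x, x * rep.σ w = x → x * rep.σ z = x := by
  obtain ⟨v, hv⟩ := (hR (w - w * u)).2
  have hz : ∀ x, x * rep.σ (u + v - u * v) =
      (x - x * rep.σ u) * rep.σ v + x * rep.σ u := by
    intro x
    rw [map_σ_sub, rep.σ_add, rep.σ_mul]
    noncomm_ring
  refine ⟨u + v - u * v, fun x hx => ?_, fun x hx => ?_⟩
  · rw [hz, hx, sub_self, zero_mul, zero_add]
  · have h : x * rep.σ (w - w * u) = x - x * rep.σ u := by
      rw [map_σ_sub, rep.σ_mul, mul_sub, ← mul_assoc, hx]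
    rw [hz, ← h, mul_assoc, ← rep.σ_mul, hv, h, sub_add_cancel]

end CovRep

namespace GradedCovRep

variable {R P Q B : Type*} [NonUnitalRing R] [AddCommGroup P] [AddCommGroup Q]
  [NonUnitalRing B] {sys : RSystem R P Q} (rep : GradedCovRep sys B)

theorem exists_σ_mul_eq (hsu : sys.IsSUnital) (b : B) : ∃ u : R, rep.σ u * b = b := by
  have hb : b ∈ NonUnitalSubring.closure (Set.range rep.σ ∪ Set.range rep.S ∪ Set.range rep.T) :=
    rep.surjective ▸ NonUnitalSubring.mem_top b
  induction hb using NonUnitalSubring.closure_induction with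
  | mem x hx =>
    rcases hx with (⟨r, rfl⟩ | ⟨p, rfl⟩) | ⟨q, rfl⟩
    · obtain ⟨u, hu⟩ := (hsu.1 r).1
      exact ⟨u, by rw [← rep.σ_mul, hu]⟩
    · obtain ⟨u, hu⟩ := (hsu.2.1 p).1
      exact ⟨u, by rw [← rep.S_lsmul, hu]⟩
    · obtain ⟨u, hu⟩ := (hsu.2.2 q).1
      exact ⟨u, by rw [← rep.T_lsmul, hu]⟩
  | zero => exact ⟨0, mul_zero _⟩
  | add x y _ _ hx hy =>
    obtain ⟨u, hu⟩ := hx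
    obtain ⟨w, hw⟩ := hy
    obtain ⟨z, hzu, hzw⟩ := rep.exists_common_left_unit hsu.1 u w
    exact ⟨z, by rw [mul_add, hzu x hu, hzw y hw]⟩
  | neg x _ hx =>
    obtain ⟨u, hu⟩ := hx
    exact ⟨u, by rw [mul_neg, hu]⟩
  | mul x y _ _ hx _ =>
    obtain ⟨u, hu⟩ := hx
    exact ⟨u, by rw [← mul_assoc, hu]⟩

theorem exists_mul_σ_eq (hsu : sys.IsSUnital) (b : B) : ∃ u : R, b * rep.σ u = b := by
  have hb : b ∈ NonUnitalSubring.closure (Set.range rep.σ ∪ Set.range rep.S ∪ Set.range rep.T) :=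
    rep.surjective ▸ NonUnitalSubring.mem_top b
  induction hb using NonUnitalSubring.closure_induction with
  | mem x hx =>
    rcases hx with (⟨r, rfl⟩ | ⟨p, rfl⟩) | ⟨q, rfl⟩
    · obtain ⟨u, hu⟩ := (hsu.1 r).2
      exact ⟨u, by rw [← rep.σ_mul, hu]⟩
    · obtain ⟨u, hu⟩ := (hsu.2.1 p).2
      exact ⟨u, by rw [← rep.S_rsmul, hu]⟩
    · obtain ⟨u, hu⟩ := (hsu.2.2 q).2
      exact ⟨u, by rw [← rep.T_rsmul, hu]⟩
  | zero => exact ⟨0, zero_mul _⟩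
  | add x y _ _ hx hy =>
    obtain ⟨u, hu⟩ := hx
    obtain ⟨w, hw⟩ := hy
    obtain ⟨z, hzu, hzw⟩ := rep.exists_common_right_unit hsu.1 u w
    exact ⟨z, by rw [add_mul, hzu x hu, hzw y hw]⟩
  | neg x _ hx =>
    obtain ⟨u, hu⟩ := hx
    exact ⟨u, by rw [neg_mul, hu]⟩
  | mul x y _ _ _ hy =>
    obtain ⟨u, hu⟩ := hy
    exact ⟨u, by rw [mul_assoc, hu]⟩

theorem σ_mem_sMul (hsu : sys.IsSUnital) (u : R) :
    rep.σ u ∈ sMul (rep.grading.comp 0) (rep.grading.comp (-0)) := by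
  obtain ⟨v, hv⟩ := (hsu.1 u).1
  rw [← hv, rep.σ_mul]
  exact mul_mem_sMul (rep.σ_mem v) (by simpa using rep.σ_mem u)

theorem hasLeftUnits_zero (hsu : sys.IsSUnital) : rep.grading.HasLeftUnits 0 := by
  intro L _
  suffices h : ∃ u : R, ∀ s ∈ L, rep.σ u * s = s by
    obtain ⟨u, hu⟩ := h
    exact ⟨rep.σ u, rep.σ_mem_sMul hsu u, hu⟩
  clear * - hsu
  induction L with
  | nil => exact ⟨0, by simp⟩
  | cons b L ih =>
    obtain ⟨u, hu⟩ := ih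
    obtain ⟨w, hw⟩ := rep.exists_σ_mul_eq hsu b
    obtain ⟨z, hzu, hzw⟩ := rep.exists_common_left_unit hsu.1 u w
    exact ⟨z, List.forall_mem_cons.2 ⟨hzw b hw, fun s hs => hzu s (hu s hs)⟩⟩

theorem hasRightUnits_zero (hsu : sys.IsSUnital) : rep.grading.HasRightUnits 0 := by
  intro L _
  suffices h : ∃ u : R, ∀ s ∈ L, s * rep.σ u = s by
    obtain ⟨u, hu⟩ := h
    exact ⟨rep.σ u, rep.σ_mem_sMul hsu u, hu⟩
  clear * - hsu
  induction L with
  | nil => exact ⟨0, by simp⟩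
  | cons b L ih =>
    obtain ⟨u, hu⟩ := ih
    obtain ⟨w, hw⟩ := rep.exists_mul_σ_eq hsu b
    obtain ⟨z, hzu, hzw⟩ := rep.exists_common_right_unit hsu.1 u w
    exact ⟨z, List.forall_mem_cons.2 ⟨hzw b hw, fun s hs => hzu s (hu s hs)⟩⟩

/-- `rep.Word d b` says that `b` is a monomial `T(q₁) ⋯ T(qₘ) σ(r) S(p₁) ⋯ S(pₙ)` of degree
`d = m - n`. -/
inductive Word : ℤ → B → Prop
  | base (r : R) : Word 0 (rep.σ r)
  | mulLeft (d : ℤ) (b : B) (q : Q) : Word d b → Word (d + 1) (rep.T q * b)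
  | mulRight (d : ℤ) (b : B) (p : P) : Word d b → Word (d - 1) (b * rep.S p)

variable {rep}

theorem Word.mem_comp {d : ℤ} {b : B} (h : rep.Word d b) : b ∈ rep.grading.comp d := by
  induction h with
  | base r => exact rep.σ_mem r
  | mulLeft d b q _ ih => exact rep.grading.mul_mem_of_eq (rep.T_mem q) ih (by ring)
  | mulRight d b p _ ih => exact rep.grading.mul_mem_of_eq ih (rep.S_mem p) (by ring)

theorem Word.exists_eq_T_mul {d : ℤ} {b : B} (h : rep.Word d b) (hd : 0 < d) :
    ∃ q, ∃ b' ∈ rep.grading.comp (d - 1), b = rep.T q * b' := by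
  induction h with
  | base r => exact absurd hd (lt_irrefl 0)
  | mulLeft d b q hb _ => exact ⟨q, b, by simpa using hb.mem_comp, rfl⟩
  | mulRight d b p _ ih =>
    obtain ⟨q, b', hb', rfl⟩ := ih (by omega)
    exact ⟨q, b' * rep.S p, rep.grading.mul_mem_of_eq hb' (rep.S_mem p) (by ring),
      mul_assoc _ _ _⟩

theorem Word.exists_eq_mul_S {d : ℤ} {b : B} (h : rep.Word d b) (hd : d < 0) :
    ∃ b' ∈ rep.grading.comp (d + 1), ∃ p, b = b' * rep.S p := by
  induction h with
  | base r => exact absurd hd (lt_irrefl 0)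
  | mulRight d b p hb _ => exact ⟨b, by simpa using hb.mem_comp, p, rfl⟩
  | mulLeft d b q _ ih =>
    obtain ⟨b', hb', p, rfl⟩ := ih (by omega)
    exact ⟨rep.T q * b', rep.grading.mul_mem_of_eq (rep.T_mem q) hb' (by ring), p,
      (mul_assoc _ _ _).symm⟩

theorem Word.σ_mul {d : ℤ} {b : B} (h : rep.Word d b) (r : R) :
    rep.Word d (rep.σ r * b) := by
  induction h with
  | base r' => exact rep.σ_mul r r' ▸ Word.base _
  | mulLeft d b q hb _ =>
    rw [← mul_assoc, ← rep.T_lsmul]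
    exact hb.mulLeft _ _ _
  | mulRight d b p _ ih =>
    rw [← mul_assoc]
    exact ih.mulRight _ _ _

theorem Word.S_mul (hsu : sys.IsSUnital) {d : ℤ} {b : B} (h : rep.Word d b) (p : P) :
    ∃ d', rep.Word d' (rep.S p * b) := by
  induction h with
  | base r =>
    obtain ⟨u, hu⟩ := (hsu.2.1 (sys.actP.rsmul p r)).1
    rw [← rep.S_rsmul, ← hu, rep.S_lsmul]
    exact ⟨_, (Word.base u).mulRight _ _ _⟩
  | mulLeft d b q hb _ =>
    rw [← mul_assoc, ← rep.σ_psi]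
    exact ⟨d, hb.σ_mul _⟩
  | mulRight d b p' _ ih =>
    obtain ⟨d', hd'⟩ := ih
    rw [← mul_assoc]
    exact ⟨_, hd'.mulRight _ _ _⟩

variable (rep)

theorem closure_word (hsu : sys.IsSUnital) :
    AddSubgroup.closure {b | ∃ d, rep.Word d b} = ⊤ := by
  have hmul : ∀ x y : B, y ∈ AddSubgroup.closure {b | ∃ d, rep.Word d b} →
      x * y ∈ AddSubgroup.closure {b | ∃ d, rep.Word d b} := by
    intro x
    have hx : x ∈
        NonUnitalSubring.closure (Set.range rep.σ ∪ Set.range rep.S ∪ Set.range rep.T) :=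
      rep.surjective ▸ NonUnitalSubring.mem_top x
    induction hx using NonUnitalSubring.closure_induction with
    | mem x hx =>
      have hword : ∀ d b, rep.Word d b → ∃ d', rep.Word d' (x * b) := by
        intro d b hb
        rcases hx with (⟨r, rfl⟩ | ⟨p, rfl⟩) | ⟨q, rfl⟩
        · exact ⟨d, hb.σ_mul r⟩
        · exact hb.S_mul hsu p
        · exact ⟨_, hb.mulLeft _ _ q⟩
      intro y hy
      induction hy using AddSubgroup.closure_induction with
      | mem y hy =>
        obtain ⟨d, hd⟩ := hy
        exact AddSubgroup.subset_closure (hword d y hd)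
      | zero => simp
      | add y z _ _ hy hz =>
        rw [mul_add]
        exact add_mem hy hz
      | neg y _ hy =>
        rw [mul_neg]
        exact neg_mem hy
    | zero => simp
    | add x x' _ _ hx hx' =>
      intro y hy
      rw [add_mul]
      exact add_mem (hx y hy) (hx' y hy)
    | neg x _ hx =>
      intro y hy
      rw [neg_mul]
      exact neg_mem (hx y hy)
    | mul x x' _ _ hx hx' =>
      intro y hy
      rw [mul_assoc]
      exact hx _ (hx' y hy)
  refine (AddSubgroup.eq_top_iff' _).2 fun b => ?_
  obtain ⟨u, hu⟩ := rep.exists_mul_σ_eq hsu b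
  exact hu ▸ hmul b _ (AddSubgroup.subset_closure ⟨0, Word.base u⟩)

theorem comp_le_closure_T_mul (hsu : sys.IsSUnital) {i : ℤ} (hi : 0 < i) :
    rep.grading.comp i ≤ AddSubgroup.closure
      {z : B | ∃ a ∈ Set.range rep.T, ∃ b ∈ (Set.univ : Set B), z = a * b} := by
  refine (rep.grading.comp_le_closure rep.Word (fun _ _ h => h.mem_comp)
    (rep.closure_word hsu) i).trans (AddSubgroup.closure_mono fun b hb => ?_)
  obtain ⟨q, b', -, rfl⟩ := Word.exists_eq_T_mul hb hi
  exact ⟨_, ⟨q, rfl⟩, b', trivial, rfl⟩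

theorem comp_le_closure_mul_S (hsu : sys.IsSUnital) {i : ℤ} (hi : i < 0) :
    rep.grading.comp i ≤ AddSubgroup.closure
      {z : B | ∃ a ∈ (Set.univ : Set B), ∃ b ∈ Set.range rep.S, z = a * b} := by
  refine (rep.grading.comp_le_closure rep.Word (fun _ _ h => h.mem_comp)
    (rep.closure_word hsu) i).trans (AddSubgroup.closure_mono fun b hb => ?_)
  obtain ⟨b', -, p, rfl⟩ := Word.exists_eq_mul_S hb hi
  exact ⟨b', trivial, _, ⟨p, rfl⟩, rfl⟩

theorem hasLeftUnits (hsu : sys.IsSUnital) (hfs : CondFS sys) (i : ℕ) :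
    rep.grading.HasLeftUnits i := by
  induction i with
  | zero => exact rep.hasLeftUnits_zero hsu
  | succ i ih =>
    rw [Nat.cast_succ]
    intro L hL
    obtain ⟨M, hM, hMe⟩ := exists_list_left_of_list L fun s hs =>
      rep.comp_le_closure_T_mul hsu (by omega) (hL s hs)
    obtain ⟨e, he, heM⟩ := rep.exists_left_unit_of_condFS hfs M hM
    obtain ⟨e', he', heq⟩ := ih.exists_mul_eq (Set.forall_mem_range.2 rep.T_mem)
      (Set.forall_mem_range.2 rep.S_mem) hL he
    exact ⟨e', he', fun s hs => (heq s hs).trans (hMe e heM s hs)⟩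

theorem hasRightUnits (hsu : sys.IsSUnital) (hfs : CondFS sys) (i : ℕ) :
    rep.grading.HasRightUnits i := by
  induction i with
  | zero => exact rep.hasRightUnits_zero hsu
  | succ i ih =>
    rw [Nat.cast_succ]
    intro L hL
    obtain ⟨M, hM, hMe⟩ := exists_list_right_of_list L fun s hs =>
      rep.comp_le_closure_mul_S hsu (by omega) (hL s hs)
    obtain ⟨e, he, heM⟩ := rep.exists_right_unit_of_condFS hfs M hM
    obtain ⟨e', he', heq⟩ := ih.exists_mul_eq (Set.forall_mem_range.2 rep.T_mem)
      (Set.forall_mem_range.2 rep.S_mem) hL he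
    exact ⟨e', he', fun s hs => (heq s hs).trans (hMe e heM s hs)⟩

end GradedCovRep

/-- Let `R` be an s-unital ring, `(P,Q,ψ)` an s-unital `R`-system satisfying
Condition (FS), and `(S,T,σ,B)` a graded covariant representation. Then:
(a) every `s ∈ B_i` (`i ≥ 0`) has a left unit in `B_i B_{-i}`,
(b) every `t ∈ B_{-i}` (`i ≥ 0`) has a right unit in `B_i B_{-i}`,
(c) `B_i B_{-i}` is an s-unital ring for every `i ≥ 0`, and
(d) `B_i = B_i B_{-i} B_i` for every `i ∈ ℤ` (`B` is symmetrically ℤ-graded). -/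
theorem sunital_system_condFS_consequences
    {R P Q B : Type*} [NonUnitalRing R] [AddCommGroup P] [AddCommGroup Q] [NonUnitalRing B]
    (sys : RSystem R P Q) (hsu : sys.IsSUnital) (hfs : CondFS sys)
    (rep : GradedCovRep sys B) :
    (∀ i : ℕ, ∀ s ∈ rep.grading.comp (i : ℤ),
        ∃ ε ∈ sMul (rep.grading.comp (i : ℤ)) (rep.grading.comp (-(i : ℤ))), ε * s = s) ∧
    (∀ i : ℕ, ∀ t ∈ rep.grading.comp (-(i : ℤ)),
        ∃ ε ∈ sMul (rep.grading.comp (i : ℤ)) (rep.grading.comp (-(i : ℤ))), t * ε = t) ∧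
    (∀ i : ℕ, ∀ x ∈ sMul (rep.grading.comp (i : ℤ)) (rep.grading.comp (-(i : ℤ))),
        (∃ e ∈ sMul (rep.grading.comp (i : ℤ)) (rep.grading.comp (-(i : ℤ))), e * x = x) ∧
        (∃ f ∈ sMul (rep.grading.comp (i : ℤ)) (rep.grading.comp (-(i : ℤ))), x * f = x)) ∧
    (∀ i : ℤ, sMul (sMul (rep.grading.comp i) (rep.grading.comp (-i))) (rep.grading.comp i)
        = rep.grading.comp i) := by
  refine ⟨fun i s hs => ?_, fun i t ht => ?_, fun i x hx => ⟨?_, ?_⟩, fun i => ?_⟩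
  · obtain ⟨e, he, hes⟩ := rep.hasLeftUnits hsu hfs i [s] (by simpa using hs)
    exact ⟨e, he, hes s (by simp)⟩
  · obtain ⟨e, he, het⟩ := rep.hasRightUnits hsu hfs i [t] (by simpa using ht)
    exact ⟨e, he, het t (by simp)⟩
  · obtain ⟨L, hL, hLe⟩ := exists_list_left hx
    obtain ⟨e, he, heL⟩ := rep.hasLeftUnits hsu hfs i L hL
    exact ⟨e, he, hLe e heL⟩
  · obtain ⟨L, hL, hLe⟩ := exists_list_right hx
    obtain ⟨e, he, heL⟩ := rep.hasRightUnits hsu hfs i L hL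
    exact ⟨e, he, hLe e heL⟩
  · obtain ⟨n, rfl | rfl⟩ := i.eq_nat_or_neg
    · exact (rep.hasLeftUnits hsu hfs n).sMul_sMul_eq
    · rw [neg_neg]
      exact (rep.hasRightUnits hsu hfs n).sMul_sMul_eq
end
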